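/- arXiv:1405.3604 — 4 statements merged into one kernel-verified Lean document; each statement's English description precedes it below -/
import Mathlib

section
/- Let G be a countable group acting ergodically by measure-preserving Borel bijections on a standard probability space (X, μ), let F be a G-invariant sub-σ-algebra, and let ξ be a countable Borel partition with H(ξ | F) < ∞. Then for every ε > 0 there is a finite Borel partition α of X with σ_G(α) ∨ F = σ_G(ξ) ∨ F (up to μ-null sets) and H(α | F) < H(ξ | F) + ε. -/
open MeasureTheory Real ENNReal

section Defs

variable {X : Type*} {mX : MeasurableSpace X}

/-- The smallest `G`-invariant sub-σ-algebra containing the collection `C`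
(together with `X`) and all `μ`-null sets. -/
def sigmaG (G : Type*) [Group G] [MulAction G X] (μ : Measure X) (C : Set (Set X)) :
    MeasurableSpace X :=
  sInf {m : MeasurableSpace X |
    (∀ S ∈ C, MeasurableSet[m] S) ∧
    (∀ S : Set X, MeasurableSet[m] S → ∀ g : G, MeasurableSet[m] ((fun x => g • x) ⁻¹' S)) ∧
    (∀ S : Set X, μ S = 0 → MeasurableSet[m] S)}

/-- The action of `G` on `(X, μ)` is by measure-preserving (Borel) bijections. -/
def IsPmpAction (G : Type*) [Group G] [MulAction G X] (μ : Measure X) : Prop :=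
  ∀ g : G, @MeasurePreserving X X mX mX (fun x : X => g • x) μ μ

/-- The action is ergodic: every `G`-invariant Borel set is null or conull. -/
def IsErgodicAction (G : Type*) [Group G] [MulAction G X] (μ : Measure X) : Prop :=
  ∀ A : Set X, MeasurableSet[mX] A → (∀ g : G, (fun x => g • x) ⁻¹' A = A) →
    μ A = 0 ∨ μ A = 1

/-- A countable Borel partition (as an indexed family): measurable, pairwise
disjoint sets whose union is conull. -/
def IsPartition {ι : Type*} (μ : Measure X) (A : ι → Set X) : Prop :=
  (∀ i, MeasurableSet[mX] (A i)) ∧ Pairwise (Function.onFun Disjoint A) ∧ μ (⋃ i, A i) = 1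

/-- The partition is generating: `σ_G(A)` is the full Borel σ-algebra (up to null
sets; `σ_G(A)` contains all null sets, so this is containment of the Borel sets). -/
def IsGenerating (G : Type*) [Group G] [MulAction G X] {ι : Type*} (μ : Measure X)
    (A : ι → Set X) : Prop :=
  mX ≤ sigmaG G μ (Set.range A)

/-- Shannon entropy of a countable partition, valued in `ℝ≥0∞`. -/
noncomputable def partitionEntropy {ι : Type*} (μ : Measure X) (A : ι → Set X) : ℝ≥0∞ :=
  ∑' i, ENNReal.ofReal (negMulLog (μ (A i)).toReal)

/-- Shannon entropy of a (finite or countable) probability vector, valued in `ℝ≥0∞`. -/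
noncomputable def vecEntropy {ι : Type*} (p : ι → ℝ) : ℝ≥0∞ :=
  ∑' i, ENNReal.ofReal (negMulLog (p i))

/-- Rokhlin entropy: the infimum of the Shannon entropies of countable Borel
generating partitions. -/
noncomputable def rokhlinEntropy (G : Type*) [Group G] [MulAction G X] (μ : Measure X) :
    ℝ≥0∞ :=
  ⨅ (A : ℕ → Set X) (_ : IsPartition μ A ∧ IsGenerating G μ A), partitionEntropy μ A

end Defs

section RelDefs

variable {X : Type*} {mX : MeasurableSpace X}

/-- `F` is a `G`-invariant sub-σ-algebra. -/
def IsInvariantAlg (G : Type*) [Group G] [MulAction G X] (F : MeasurableSpace X) : Prop :=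
  ∀ S : Set X, MeasurableSet[F] S → ∀ g : G, MeasurableSet[F] ((fun x => g • x) ⁻¹' S)

/-- Conditional Shannon entropy `H(α | F)` of a countable partition relative to a
sub-σ-algebra `F`, defined via conditional expectations of indicator functions. -/
noncomputable def condPartitionEntropy (μ : Measure X) (F : MeasurableSpace X)
    {ι : Type*} (A : ι → Set X) : ℝ≥0∞ :=
  ∫⁻ x, ∑' i, ENNReal.ofReal
    (negMulLog ((μ[(A i).indicator (fun _ => (1 : ℝ)) | F]) x)) ∂μ

/-- Relative Rokhlin entropy `rh_G(X, μ | F)`: the infimum of `H(α | F)` over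
countable Borel partitions `α` with `σ_G(α) ∨ F` equal to the Borel σ-algebra
(up to null sets). -/
noncomputable def relRokhlinEntropy (G : Type*) [Group G] [MulAction G X]
    (μ : Measure X) (F : MeasurableSpace X) : ℝ≥0∞ :=
  ⨅ (A : ℕ → Set X)
    (_ : IsPartition μ A ∧ mX ≤ sigmaG G μ (Set.range A) ⊔ F),
    condPartitionEntropy μ F A

/-- A countable partition `B` extends the pre-partition `A`: the restriction of
`B` to `⋃ A` coincides with `A` (ignoring empty sets). -/
def PartExtends {ι : Type*} (B : ℕ → Set X) (A : ι → Set X) : Prop :=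
  Set.range (fun j => B j ∩ ⋃ i, A i) \ {∅} = Set.range A \ {∅}

/-- The reduced σ-algebra `ralg_G(α) = ⋂_{β ⊒ α} σ_G(β)`, the intersection over
all countable Borel partitions `β` extending the pre-partition `α`. -/
def rAlg (G : Type*) [Group G] [MulAction G X] (μ : Measure X) {ι : Type*}
    (A : ι → Set X) : MeasurableSpace X :=
  ⨅ (B : ℕ → Set X) (_ : IsPartition μ B ∧ PartExtends B A), sigmaG G μ (Set.range B)

end RelDefs

section GreedyMatching

variable {X G : Type*} [Group G] [MulAction G X]

/-- The parts of `A` and `B` left unmatched after the first `n` steps of the greedy matching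
of `A` with `B` along the enumeration `e`: at step `n` a point `x` left in `A` is matched with
`e n • x` whenever the latter is left in `B`. -/
def greedyRem (e : ℕ → G) (A B : Set X) : ℕ → Set X × Set X
  | 0 => (A, B)
  | n + 1 =>
    ((greedyRem e A B n).1 \ (fun x => e n • x) ⁻¹' (greedyRem e A B n).2,
      (greedyRem e A B n).2 \ (fun x => (e n)⁻¹ • x) ⁻¹' (greedyRem e A B n).1)

/-- The part of `A` never matched. -/
def unmatchedLeft (e : ℕ → G) (A B : Set X) : Set X := ⋂ n, (greedyRem e A B n).1

/-- The part of `B` never matched. -/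
def unmatchedRight (e : ℕ → G) (A B : Set X) : Set X := ⋂ n, (greedyRem e A B n).2

/-- The image of `D ⊆ A` under the greedy matching. -/
def greedyPush (e : ℕ → G) (A B D : Set X) : Set X :=
  ⋃ n, (greedyRem e A B n).2 ∩ (fun x => (e n)⁻¹ • x) ⁻¹' ((greedyRem e A B n).1 ∩ D)

/-- The preimage of `S` under the greedy matching. -/
def greedyPull (e : ℕ → G) (A B S : Set X) : Set X :=
  ⋃ n, (greedyRem e A B n).1 ∩ (fun x => e n • x) ⁻¹' ((greedyRem e A B n).2 ∩ S)

variable (e : ℕ → G) (A B : Set X)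

lemma antitone_greedyRem_fst : Antitone fun n => (greedyRem e A B n).1 :=
  antitone_nat_of_succ_le fun _ => Set.sdiff_subset

lemma antitone_greedyRem_snd : Antitone fun n => (greedyRem e A B n).2 :=
  antitone_nat_of_succ_le fun _ => Set.sdiff_subset

lemma unmatchedRight_subset : unmatchedRight e A B ⊆ B := Set.iInter_subset _ 0

lemma smul_notMem_unmatchedRight {x : X} (hx : x ∈ unmatchedLeft e A B) (n : ℕ) :
    e n • x ∉ unmatchedRight e A B := by
  intro h
  simp only [unmatchedLeft, unmatchedRight, Set.mem_iInter] at hx h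
  exact (hx (n + 1)).2 (h n)

lemma greedyPush_subset (D : Set X) : greedyPush e A B D ⊆ B \ unmatchedRight e A B := by
  intro y hy
  simp only [greedyPush, Set.mem_iUnion] at hy
  obtain ⟨n, hB, hA, -⟩ := hy
  refine ⟨antitone_greedyRem_snd e A B (Nat.zero_le n) hB, fun h => ?_⟩
  simp only [unmatchedRight, Set.mem_iInter] at h
  exact (h (n + 1)).2 hA

lemma greedyPull_eq {D S : Set X} (hD : D ⊆ A)
    (hS : S ∩ (B \ unmatchedRight e A B) = greedyPush e A B D) :
    greedyPull e A B S = D \ unmatchedLeft e A B := by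
  ext x
  simp only [greedyPull, Set.mem_iUnion]
  constructor
  · rintro ⟨n, hA, hB, hxS⟩
    have hnB : e n • x ∉ (greedyRem e A B (n + 1)).2 := fun h => h.2 (by simpa using hA)
    have hmem : e n • x ∈ S ∩ (B \ unmatchedRight e A B) :=
      ⟨hxS, antitone_greedyRem_snd e A B (Nat.zero_le n) hB, fun h =>
        hnB (Set.mem_iInter.1 h (n + 1))⟩
    rw [hS] at hmem
    simp only [greedyPush, Set.mem_iUnion] at hmem
    obtain ⟨k, hkB, hkA, hkD⟩ := hmem
    have hkn : k = n := by
      rcases lt_trichotomy k n with h | h | h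
      · exact absurd hkA (antitone_greedyRem_snd e A B (Nat.succ_le_of_lt h) hB).2
      · exact h
      · exact absurd (antitone_greedyRem_snd e A B (Nat.succ_le_of_lt h) hkB) hnB
    subst hkn
    refine ⟨by simpa using hkD, fun h => ?_⟩
    exact (Set.mem_iInter.1 h (k + 1)).2 hB
  · rintro ⟨hxD, hx⟩
    simp only [unmatchedLeft, Set.mem_iInter, not_forall] at hx
    classical
    have hpos : Nat.find hx ≠ 0 := fun h => by
      have := Nat.find_spec hx
      rw [h] at this
      exact this (hD hxD)
    obtain ⟨n, hn⟩ := Nat.exists_eq_succ_of_ne_zero hpos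
    have h1 : x ∈ (greedyRem e A B n).1 := by
      by_contra h
      exact Nat.find_min hx (by omega) h
    have h2 : x ∉ (greedyRem e A B (n + 1)).1 := by
      have := Nat.find_spec hx
      rwa [hn] at this
    have h3 : e n • x ∈ (greedyRem e A B n).2 := by
      by_contra h
      exact h2 ⟨h1, h⟩
    refine ⟨n, h1, h3, ?_⟩
    have : e n • x ∈ greedyPush e A B D := by
      simp only [greedyPush, Set.mem_iUnion]
      exact ⟨n, h3, by simpa using h1, by simpa using hxD⟩
    rw [← hS] at this
    exact this.1

variable {e A B}

section Measurability

variable {M : MeasurableSpace X} (hM : IsInvariantAlg G M)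
  (hA : MeasurableSet[M] A) (hB : MeasurableSet[M] B)
include hM hA hB

lemma measurableSet_greedyRem (n : ℕ) :
    MeasurableSet[M] (greedyRem e A B n).1 ∧ MeasurableSet[M] (greedyRem e A B n).2 := by
  induction n with
  | zero => exact ⟨hA, hB⟩
  | succ n ih => exact ⟨ih.1.diff (hM _ ih.2 _), ih.2.diff (hM _ ih.1 _)⟩

lemma measurableSet_unmatchedLeft : MeasurableSet[M] (unmatchedLeft e A B) :=
  .iInter fun n => (measurableSet_greedyRem hM hA hB n).1

lemma measurableSet_unmatchedRight : MeasurableSet[M] (unmatchedRight e A B) :=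
  .iInter fun n => (measurableSet_greedyRem hM hA hB n).2

lemma measurableSet_greedyPush {D : Set X} (hD : MeasurableSet[M] D) :
    MeasurableSet[M] (greedyPush e A B D) :=
  .iUnion fun n => (measurableSet_greedyRem hM hA hB n).2.inter
    (hM _ ((measurableSet_greedyRem hM hA hB n).1.inter hD) _)

lemma measurableSet_greedyPull {S : Set X} (hS : MeasurableSet[M] S) :
    MeasurableSet[M] (greedyPull e A B S) :=
  .iUnion fun n => (measurableSet_greedyRem hM hA hB n).1.inter
    (hM _ ((measurableSet_greedyRem hM hA hB n).2.inter hS) _)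

end Measurability

lemma IsPmpAction.isInvariantAlg {mX : MeasurableSpace X} {μ : Measure X}
    (hpmp : IsPmpAction G μ) : IsInvariantAlg G mX :=
  fun _ hS g => (hpmp g).measurable hS

section Measure

variable {mX : MeasurableSpace X} {μ : Measure X} [IsProbabilityMeasure μ]
  (hpmp : IsPmpAction G μ) (hA : MeasurableSet A) (hB : MeasurableSet B)
include hpmp hA hB

lemma measure_greedyRem (n : ℕ) :
    μ (greedyRem e A B n).1 + μ B = μ (greedyRem e A B n).2 + μ A := by
  induction n with
  | zero => exact add_comm _ _
  | succ n ih =>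
    obtain ⟨h1, h2⟩ := measurableSet_greedyRem (e := e) hpmp.isInvariantAlg hA hB n
    set P := (greedyRem e A B n).1
    set Q := (greedyRem e A B n).2
    have key : μ (P ∩ (fun x => e n • x) ⁻¹' Q) = μ (Q ∩ (fun x => (e n)⁻¹ • x) ⁻¹' P) := by
      rw [← (hpmp (e n)⁻¹).measure_preimage
        (h1.inter (hpmp.isInvariantAlg _ h2 _)).nullMeasurableSet]
      congr 1
      ext x
      simp [and_comm]
    have e1 := measure_sdiff_add_inter (μ := μ) P (hpmp.isInvariantAlg _ h2 (e n))
    have e2 := measure_sdiff_add_inter (μ := μ) Q (hpmp.isInvariantAlg _ h1 (e n)⁻¹)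
    rw [← e1, ← e2, key, add_right_comm, add_right_comm (μ (Q \ _))] at ih
    exact (ENNReal.add_left_inj (measure_ne_top _ _)).1 ih

lemma measure_unmatched :
    μ (unmatchedLeft e A B) + μ B = μ (unmatchedRight e A B) + μ A := by
  have h := measurableSet_greedyRem (e := e) hpmp.isInvariantAlg hA hB
  have t1 := tendsto_measure_iInter_atTop (μ := μ)
    (fun n => (h n).1.nullMeasurableSet) (antitone_greedyRem_fst e A B)
    ⟨0, measure_ne_top _ _⟩
  have t2 := tendsto_measure_iInter_atTop (μ := μ)
    (fun n => (h n).2.nullMeasurableSet) (antitone_greedyRem_snd e A B)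
    ⟨0, measure_ne_top _ _⟩
  refine tendsto_nhds_unique (t1.add_const (μ B)) ?_
  refine (t2.add_const (μ A)).congr fun n => ?_
  exact (measure_greedyRem hpmp hA hB n).symm

lemma measure_unmatchedLeft_eq_zero (herg : IsErgodicAction G μ)
    (he : Function.Surjective e) (hle : μ A ≤ μ B) : μ (unmatchedLeft e A B) = 0 := by
  have hL := measurableSet_unmatchedLeft (e := e) hpmp.isInvariantAlg hA hB
  have hsum := measure_unmatched (e := e) hpmp hA hB
  set L := unmatchedLeft e A B
  set R := unmatchedRight e A B
  set S : Set X := ⋃ n, (fun x => e n • x) ⁻¹' L with hSdef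
  have hSmem : ∀ x, x ∈ S ↔ ∃ g : G, g • x ∈ L := fun x => by
    simp only [hSdef, Set.mem_iUnion, Set.mem_preimage]
    exact ⟨fun ⟨n, h⟩ => ⟨_, h⟩, fun ⟨g, h⟩ => by
      obtain ⟨n, rfl⟩ := he g
      exact ⟨n, h⟩⟩
  have hS : MeasurableSet S := .iUnion fun n => hpmp.isInvariantAlg _ hL _
  have hinv : ∀ g : G, (fun x => g • x) ⁻¹' S = S := fun g => by
    ext x
    simp only [Set.mem_preimage, hSmem]
    exact ⟨fun ⟨k, h⟩ => ⟨k * g, by rwa [mul_smul]⟩,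
      fun ⟨k, h⟩ => ⟨k * g⁻¹, by rwa [mul_smul, inv_smul_smul]⟩⟩
  rcases herg S hS hinv with h0 | h1
  · exact measure_mono_null (fun x hx => (hSmem x).2 ⟨1, by simpa using hx⟩) h0
  · have hR0 : μ R = 0 := by
      refine measure_mono_null (fun x hx => ?_) ((prob_compl_eq_zero_iff hS).2 h1)
      rw [Set.mem_compl_iff, hSmem]
      rintro ⟨g, hg⟩
      obtain ⟨n, hn⟩ := he g⁻¹
      apply smul_notMem_unmatchedRight e A B hg n
      simpa [hn] using hx
    rw [hR0, zero_add] at hsum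
    have : μ L + μ B ≤ 0 + μ B := by rw [hsum, zero_add]; exact hle
    exact le_zero_iff.1 ((ENNReal.add_le_add_iff_right (measure_ne_top _ _)).1 this)

end Measure

end GreedyMatching

/-- A set that agrees with a measurable set up to a null set is measurable, in a σ-algebra
containing all null sets. -/
lemma measurableSet_of_null_symmDiff {X : Type*} {_ : MeasurableSpace X} {μ : Measure X}
    {N : MeasurableSpace X} (hN : ∀ S : Set X, μ S = 0 → MeasurableSet[N] S) {S T : Set X}
    (hT : MeasurableSet[N] T) (h1 : μ (S \ T) = 0) (h2 : μ (T \ S) = 0) :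
    MeasurableSet[N] S := by
  have : S = (T \ (T \ S)) ∪ (S \ T) := by
    ext x
    by_cases hx : x ∈ T <;> simp [hx]
  rw [this]
  exact (hT.diff (hN _ h2)).union (hN _ h1)

/-- The set left free after `i` steps, when the sets `U 0, U 1, …` are successively matched with
disjoint sets. -/
def freePart {X G : Type*} [Group G] [MulAction G X] (e : ℕ → G) (U : ℕ → Set X) : ℕ → Set X
  | 0 => Set.univ
  | i + 1 => unmatchedRight e (U i) (freePart e U i)

/-- In an ergodic system, a sequence of sets `E i ⊆ U i` with `∑ i, μ (U i) ≤ 1` can be coded by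
a single set `Γ` of measure at most `∑ i, μ (U i)`, from which the sets `E i` can be recovered
successively as long as `U i` is known from the sets `E j` with `j < i`. -/
theorem exists_coding_set {X G : Type*} {M : MeasurableSpace X} [mX : MeasurableSpace X]
    [Group G] [Countable G] [MulAction G X] {μ : Measure X} [IsProbabilityMeasure μ]
    (hpmp : IsPmpAction G μ) (herg : IsErgodicAction G μ)
    (hMle : M ≤ mX) (hM : IsInvariantAlg G M) {U E : ℕ → Set X}
    (hU : ∀ i, MeasurableSet[M] (U i)) (hE : ∀ i, MeasurableSet[M] (E i))
    (hEU : ∀ i, E i ⊆ U i) (hsum : ∑' i, μ (U i) ≤ 1) :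
    ∃ Γ : Set X, MeasurableSet[M] Γ ∧ μ Γ ≤ ∑' i, μ (U i) ∧
      ∀ N : MeasurableSpace X, IsInvariantAlg G N → (∀ S : Set X, μ S = 0 → MeasurableSet[N] S) →
        MeasurableSet[N] Γ → (∀ i, (∀ j < i, MeasurableSet[N] (E j)) → MeasurableSet[N] (U i)) →
        ∀ i, MeasurableSet[N] (E i) := by
  obtain ⟨e, he⟩ := exists_surjective_nat G
  set W := freePart e U with hW
  have hWM : ∀ i, MeasurableSet[M] (W i) := fun i => by
    induction i with
    | zero => exact MeasurableSet.univ
    | succ i ih => exact measurableSet_unmatchedRight hM (hU i) ih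
  have hWanti : Antitone W := antitone_nat_of_succ_le fun i => unmatchedRight_subset e _ _
  have hUX := fun i => hMle _ (hU i)
  have hWX := fun i => hMle _ (hWM i)
  have hstep : ∀ i, μ (U i) ≤ μ (W i) → μ (W (i + 1)) + μ (U i) = μ (W i) := fun i hi => by
    have h := measure_unmatched (e := e) hpmp (hUX i) (hWX i)
    rw [measure_unmatchedLeft_eq_zero hpmp (hUX i) (hWX i) herg he hi, zero_add] at h
    exact h.symm
  have hmain : ∀ i, μ (W i) + ∑ j ∈ Finset.range i, μ (U j) = 1 ∧ μ (U i) ≤ μ (W i) := fun i => by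
    have hsum' : ∀ k, ∑ j ∈ Finset.range k, μ (U j) ≤ 1 := fun k =>
      (ENNReal.sum_le_tsum _).trans hsum
    have aux : ∀ i, μ (W i) + ∑ j ∈ Finset.range i, μ (U j) = 1 → μ (U i) ≤ μ (W i) := by
      intro i hi
      have h := hsum' (i + 1)
      rw [Finset.sum_range_succ, ← hi, add_comm] at h
      exact (ENNReal.add_le_add_iff_right
        ((hsum' i).trans_lt ENNReal.one_lt_top).ne).1 h
    induction i with
    | zero =>
      have : μ (W 0) + ∑ j ∈ Finset.range 0, μ (U j) = 1 := by
        simp [hW, freePart]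
      exact ⟨this, aux 0 this⟩
    | succ i ih =>
      have : μ (W (i + 1)) + ∑ j ∈ Finset.range (i + 1), μ (U j) = 1 := by
        rw [Finset.sum_range_succ, add_comm (∑ j ∈ _, _), ← add_assoc, hstep i ih.2, ih.1]
      exact ⟨this, aux _ this⟩
  have hle := fun i => (hmain i).2
  have hpush : ∀ i, greedyPush e (U i) (W i) (E i) ⊆ W i \ W (i + 1) := fun i =>
    greedyPush_subset e _ _ _
  refine ⟨⋃ i, greedyPush e (U i) (W i) (E i),
    .iUnion fun i => measurableSet_greedyPush hM (hU i) (hWM i) (hE i), ?_, ?_⟩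
  · refine (measure_iUnion_le _).trans (ENNReal.tsum_le_tsum fun i => ?_)
    refine (measure_mono (hpush i)).trans ?_
    rw [measure_sdiff (hWanti (Nat.le_succ i)) (hWX _).nullMeasurableSet (measure_ne_top _ _)]
    exact tsub_le_iff_left.2 (hstep i (hle i)).ge
  · intro N hN hnull hΓ hUN
    have hcap : ∀ i, (⋃ i, greedyPush e (U i) (W i) (E i)) ∩ (W i \ W (i + 1)) =
        greedyPush e (U i) (W i) (E i) := fun i => by
      refine Set.Subset.antisymm ?_ fun x hx => ⟨Set.mem_iUnion.2 ⟨i, hx⟩, hpush i hx⟩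
      rintro x ⟨hx, hxi⟩
      obtain ⟨k, hk⟩ := Set.mem_iUnion.1 hx
      have hxk := hpush k hk
      have : k = i := by
        rcases lt_trichotomy k i with h | h | h
        · exact absurd (hWanti (Nat.succ_le_of_lt h) hxi.1) hxk.2
        · exact h
        · exact absurd (hWanti (Nat.succ_le_of_lt h) hxk.1) hxi.2
      exact this ▸ hk
    have hind : ∀ i, (∀ j < i, MeasurableSet[N] (E j)) ∧ MeasurableSet[N] (W i) := fun i => by
      induction i with
      | zero => exact ⟨by simp, MeasurableSet.univ⟩
      | succ i ih =>
        have hUi := hUN i ih.1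
        refine ⟨fun j hj => ?_, measurableSet_unmatchedRight hN hUi ih.2⟩
        rcases Nat.lt_succ_iff_lt_or_eq.1 hj with h | rfl
        · exact ih.1 j h
        · have hpull := greedyPull_eq e (U j) (W j) (hEU j) (hcap j)
          have hmeas := measurableSet_greedyPull (e := e) hN hUi ih.2 hΓ
          rw [hpull] at hmeas
          refine measurableSet_of_null_symmDiff hnull hmeas ?_ ?_
          · rw [Set.sdiff_sdiff_right_self]
            exact measure_mono_null Set.inter_subset_right
              (measure_unmatchedLeft_eq_zero hpmp (hUX j) (hWX j) herg he (hle j))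
          · rw [Set.sdiff_eq_empty.2 Set.sdiff_subset, measure_empty]
    exact fun i => (hind (i + 1)).1 i (Nat.lt_succ_self i)

section Rank

/-- The number of indices preceding `n` when `p` is sorted in decreasing order, ties being broken
by the order of the indices. -/
noncomputable def rankSum (p : ℕ → ℝ≥0∞) (n : ℕ) : ℝ≥0∞ :=
  ∑' m, if p n < p m ∨ (p n = p m ∧ m < n) then 1 else 0

/-- The position of the index `n` when `p` is sorted in decreasing order. -/
noncomputable def sortedRank (p : ℕ → ℝ≥0∞) (n : ℕ) : ℕ := ⌊(rankSum p n).toReal⌋₊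

variable {p : ℕ → ℝ≥0∞}

lemma rankSum_add_one (n : ℕ) : rankSum p n + 1 =
    ∑' m, ((if p n < p m ∨ (p n = p m ∧ m < n) then 1 else 0) + if m = n then 1 else 0) := by
  rw [ENNReal.tsum_add, tsum_ite_eq, rankSum]

lemma rankSum_add_one_mul_le (n : ℕ) : (rankSum p n + 1) * p n ≤ ∑' m, p m := by
  rw [rankSum_add_one, ← ENNReal.tsum_mul_right]
  refine ENNReal.tsum_le_tsum fun m => ?_
  by_cases hm : m = n
  · subst hm
    simp
  · simp only [hm, if_false, add_zero]
    split_ifs with h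
    · rw [one_mul]
      rcases h with h | h
      · exact h.le
      · exact h.1.le
    · simp

lemma rankSum_ne_top (hp : ∑' m, p m ≤ 1) {n : ℕ} (hn : p n ≠ 0) : rankSum p n ≠ ⊤ := by
  intro h
  have := (rankSum_add_one_mul_le (p := p) n).trans hp
  rw [h, top_add, ENNReal.top_mul hn] at this
  simp at this

lemma rankSum_add_one_le_of_precedes {m n : ℕ} (h : p n < p m ∨ (p n = p m ∧ m < n)) :
    rankSum p m + 1 ≤ rankSum p n := by
  rw [rankSum_add_one, rankSum]
  refine ENNReal.tsum_le_tsum fun k => ?_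
  by_cases hk : k = m
  · subst hk
    simp [h]
  · simp only [hk, if_false, add_zero]
    by_cases hkm : p m < p k ∨ (p m = p k ∧ k < m)
    · have : p n < p k ∨ (p n = p k ∧ k < n) := by
        rcases h with h | ⟨h, h'⟩ <;> rcases hkm with hkm | ⟨hkm, hkm'⟩
        · exact Or.inl (h.trans hkm)
        · exact Or.inl (hkm ▸ h)
        · exact Or.inl (h ▸ hkm)
        · exact Or.inr ⟨h.trans hkm, hkm'.trans h'⟩
      simp [hkm, this]
    · simp [hkm]

lemma sortedRank_lt_of_precedes (hp : ∑' m, p m ≤ 1) {m n : ℕ} (hm : p m ≠ 0) (hn : p n ≠ 0)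
    (h : p n < p m ∨ (p n = p m ∧ m < n)) : sortedRank p m < sortedRank p n := by
  have h1 := ENNReal.toReal_mono (rankSum_ne_top hp hn) (rankSum_add_one_le_of_precedes h)
  rw [ENNReal.toReal_add (rankSum_ne_top hp hm) ENNReal.one_ne_top, ENNReal.toReal_one] at h1
  have h2 := Nat.floor_mono h1
  rw [Nat.floor_add_one ENNReal.toReal_nonneg] at h2
  exact h2

lemma eq_of_sortedRank_eq (hp : ∑' m, p m ≤ 1) {m n : ℕ} (hm : p m ≠ 0) (hn : p n ≠ 0)
    (h : sortedRank p m = sortedRank p n) : m = n := by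
  rcases lt_trichotomy (p m) (p n) with hlt | heq | hgt
  · exact absurd h (sortedRank_lt_of_precedes hp hn hm (Or.inl hlt)).ne'
  · rcases lt_trichotomy m n with hlt | rfl | hgt
    · exact absurd h (sortedRank_lt_of_precedes hp hm hn (Or.inr ⟨heq.symm, hlt⟩)).ne
    · rfl
    · exact absurd h (sortedRank_lt_of_precedes hp hn hm (Or.inr ⟨heq, hgt⟩)).ne'
  · exact absurd h (sortedRank_lt_of_precedes hp hm hn (Or.inl hgt)).ne

lemma size_le_one_add_two_mul_log {r : ℕ} {q : ℝ} (hq : 0 < q) (hrq : (r + 1) * q ≤ 1) :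
    (r.size : ℝ) ≤ 1 + 2 * -Real.log q := by
  have hr : (r : ℝ) + 1 ≤ q⁻¹ := by rwa [le_inv_comm₀ (by positivity) hq, ← one_div,
    le_div_iff₀ (by positivity), mul_comm]
  have hlog : Real.log (r + 1) ≤ -Real.log q := by
    rw [← Real.log_inv]
    exact Real.log_le_log (by positivity) hr
  have h0 : 0 ≤ Real.log ((r : ℝ) + 1) := Real.log_nonneg (by simp)
  rcases Nat.eq_zero_or_pos r.size with hs | hs
  · rw [hs]
    push_cast
    linarith
  · have h2 : 2 ^ (r.size - 1) ≤ r := Nat.lt_size.1 (by omega)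
    have h3 : (2 : ℝ) ^ (r.size - 1) ≤ r + 1 := by
      have : ((2 ^ (r.size - 1) : ℕ) : ℝ) ≤ r := by exact_mod_cast h2
      push_cast at this
      linarith
    have h4 := Real.log_le_log (by positivity) h3
    rw [Real.log_pow, Nat.cast_sub hs, Nat.cast_one] at h4
    have h5 := Real.log_two_gt_d9
    have h6 : (1 : ℝ) ≤ r.size := by exact_mod_cast hs
    nlinarith

lemma mul_size_sortedRank_le (hp : ∑' m, p m ≤ 1) (n : ℕ) :
    p n * (sortedRank p n).size ≤ p n + 2 * ENNReal.ofReal (negMulLog (p n).toReal) := by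
  rcases eq_or_ne (p n) 0 with h0 | h0
  · simp [h0]
  have htop : p n ≠ ⊤ := ((ENNReal.le_tsum n).trans hp).trans_lt ENNReal.one_lt_top |>.ne
  have hq : 0 < (p n).toReal := ENNReal.toReal_pos h0 htop
  have hrank : ((sortedRank p n : ℝ) + 1) * (p n).toReal ≤ 1 := by
    have h := ENNReal.toReal_mono ENNReal.one_ne_top ((rankSum_add_one_mul_le n).trans hp)
    rw [ENNReal.toReal_mul, ENNReal.toReal_add (rankSum_ne_top hp h0) ENNReal.one_ne_top,
      ENNReal.toReal_one] at h
    have := Nat.floor_le (a := (rankSum p n).toReal) ENNReal.toReal_nonneg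
    refine le_trans ?_ h
    gcongr
    exact this
  have hsize := size_le_one_add_two_mul_log hq hrank
  have hnn : 0 ≤ negMulLog (p n).toReal := by
    refine negMulLog_nonneg hq.le ?_
    exact ENNReal.toReal_le_of_le_ofReal zero_le_one (by simpa using (ENNReal.le_tsum n).trans hp)
  calc p n * (sortedRank p n).size
      = ENNReal.ofReal ((p n).toReal * (sortedRank p n).size) := by
        rw [ENNReal.ofReal_mul hq.le, ENNReal.ofReal_toReal htop, ENNReal.ofReal_natCast]
    _ ≤ ENNReal.ofReal ((p n).toReal + 2 * negMulLog (p n).toReal) := by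
        refine ENNReal.ofReal_le_ofReal ?_
        rw [negMulLog]
        nlinarith
    _ = p n + 2 * ENNReal.ofReal (negMulLog (p n).toReal) := by
        rw [ENNReal.ofReal_add hq.le (by positivity), ENNReal.ofReal_toReal htop,
          ENNReal.ofReal_mul zero_le_two, ENNReal.ofReal_ofNat]

lemma measurable_sortedRank {X : Type*} {F : MeasurableSpace X} {p : ℕ → X → ℝ≥0∞}
    (hp : ∀ n, Measurable[F] (p n)) (n : ℕ) :
    Measurable[F] fun x => sortedRank (fun m => p m x) n := by
  refine Nat.measurable_floor.comp (Measurable.ennreal_toReal (Measurable.tsum fun m => ?_))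
  refine Measurable.ite ?_ measurable_const measurable_const
  exact (measurableSet_lt (hp n) (hp m)).union
    ((measurableSet_eq_fun (hp n) (hp m)).inter (MeasurableSet.const _))

end Rank

section EntropyInequalities

lemma ofReal_negMulLog_tsum_le {ι : Type*} {p : ι → ℝ≥0∞} (hp : ∑' i, p i ≤ 1) :
    ENNReal.ofReal (negMulLog (∑' i, p i).toReal) ≤
      ∑' i, ENNReal.ofReal (negMulLog (p i).toReal) := by
  have htop : ∑' i, p i ≠ ⊤ := (hp.trans_lt ENNReal.one_lt_top).ne
  have key : ∀ a : ℝ≥0∞, a ≠ ⊤ → ∀ t : ℝ, ENNReal.ofReal (-a.toReal * t) =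
      a * ENNReal.ofReal (-t) := fun a ha t => by
    rw [neg_mul_comm, ENNReal.ofReal_mul ENNReal.toReal_nonneg, ENNReal.ofReal_toReal ha]
  rw [negMulLog, key _ htop, ← ENNReal.tsum_mul_right]
  refine ENNReal.tsum_le_tsum fun i => ?_
  have hi : p i ≠ ⊤ := ENNReal.ne_top_of_tsum_ne_top htop i
  rw [negMulLog, key _ hi]
  rcases eq_or_ne (p i) 0 with h0 | h0
  · simp [h0]
  · gcongr
    · exact ENNReal.toReal_pos h0 hi
    · exact ENNReal.le_tsum i

lemma negMulLog_le_cross {p t : ℝ} (hp : 0 ≤ p) (ht : 0 ≤ t) (hpt : 0 < p → 0 < t) :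
    negMulLog p ≤ -p * Real.log t + (t - p) := by
  rcases hp.eq_or_lt with rfl | hp
  · simpa using ht
  · have ht := hpt hp
    have h := Real.log_le_sub_one_of_pos (div_pos ht hp)
    rw [Real.log_div ht.ne' hp.ne'] at h
    have h2 := mul_le_mul_of_nonneg_left h hp.le
    have h3 : p * (t / p - 1) = t - p := by field_simp
    rw [h3] at h2
    rw [negMulLog]
    linarith

lemma sum_negMulLog_add_le {ι : Type*} [Fintype ι] {p q : ι → ℝ} (hp : ∀ i, 0 ≤ p i)
    (hq : ∀ i, 0 ≤ q i) (hsum : ∑ i, (q i + p i) = 1) :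
    ∑ i, (negMulLog (q i) + negMulLog (p i)) ≤
      ∑ i, negMulLog (q i + p i) + Real.binEntropy (∑ i, q i) := by
  set b := ∑ i, p i with hb
  set c := ∑ i, q i with hc
  have hbc : c + b = 1 := by rw [hb, hc, ← Finset.sum_add_distrib, hsum]
  have hb0 : 0 ≤ b := Finset.sum_nonneg fun i _ => hp i
  have hc0 : 0 ≤ c := Finset.sum_nonneg fun i _ => hq i
  have hpb : ∀ i, p i ≤ b := fun i =>
    Finset.single_le_sum (f := p) (fun j _ => hp j) (Finset.mem_univ i)
  have hqc : ∀ i, q i ≤ c := fun i =>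
    Finset.single_le_sum (f := q) (fun j _ => hq j) (Finset.mem_univ i)
  have cross : ∀ r a d : ℝ, 0 ≤ r → r ≤ a → r ≤ d →
      negMulLog r ≤ -r * Real.log a - r * Real.log d + (a * d - r) := by
    intro r a d hr hra hrd
    have h := negMulLog_le_cross hr (mul_nonneg (hr.trans hra) (hr.trans hrd))
      fun h => mul_pos (h.trans_le hra) (h.trans_le hrd)
    rcases hr.eq_or_lt with rfl | hr
    · simpa using h
    · rw [Real.log_mul (hr.trans_le hra).ne' (hr.trans_le hrd).ne'] at h
      linarith
  have hterm : ∀ i, negMulLog (q i) + negMulLog (p i) ≤ negMulLog (q i + p i)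
      + (q i * -Real.log c + p i * -Real.log b) + ((q i + p i) * (c + b) - (q i + p i)) := by
    intro i
    have h1 := cross (q i) (q i + p i) c (hq i) (by linarith [hp i]) (hqc i)
    have h2 := cross (p i) (q i + p i) b (hp i) (by linarith [hq i]) (hpb i)
    have h3 : negMulLog (q i + p i) = -(q i + p i) * Real.log (q i + p i) := rfl
    rw [h3]
    linarith
  refine (Finset.sum_le_sum fun i _ => hterm i).trans (le_of_eq ?_)
  rw [Real.binEntropy_eq_negMulLog_add_negMulLog_one_sub, ← hbc, add_sub_cancel_left, hbc]
  simp only [mul_one, sub_self, add_zero, Finset.sum_add_distrib, ← Finset.sum_mul]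
  rw [← hb, ← hc, negMulLog, negMulLog]
  ring

end EntropyInequalities

open ProbabilityTheory

lemma tsum_tsum_indicator_fiber {ι κ : Type*} (g : ι → κ) (w : κ → ι → ℝ≥0∞) :
    ∑' j, ∑' n, {n | g n = j}.indicator (w j) n = ∑' n, w (g n) n := by
  classical
  rw [ENNReal.tsum_comm]
  refine tsum_congr fun n => (tsum_eq_single (g n) fun j hj => ?_).trans ?_
  · exact Set.indicator_of_notMem (s := {m | g m = j}) (fun h => hj h.symm) _
  · exact Set.indicator_of_mem (s := {m | g m = g n}) rfl _

lemma tsum_measure_fiber {X ι : Type*} [MeasurableSpace X] [Countable ι] [MeasurableSpace ι]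
    [MeasurableSingletonClass ι] {f : X → ι} (hf : Measurable f) (ν : Measure X)
    [IsProbabilityMeasure ν] : ∑' n, ν (f ⁻¹' {n}) = 1 := by
  rw [← measure_iUnion _ fun n => hf (measurableSet_singleton n), ← Set.preimage_iUnion,
    Set.iUnion_of_singleton, Set.preimage_univ, measure_univ]
  exact fun m n hmn => Disjoint.preimage f (Set.disjoint_singleton.2 hmn)

lemma tsum_negMulLog_refine_le {X κ : Type*} [MeasurableSpace X] [Fintype κ] [MeasurableSpace κ]
    [MeasurableSingletonClass κ] {c : X → κ} (hc : Measurable c) {Γ : Set X}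
    (hΓ : MeasurableSet Γ) (ν : Measure X) [IsProbabilityMeasure ν] :
    ∑' k : κ × Bool, ENNReal.ofReal (negMulLog
        (ν (c ⁻¹' {k.1} ∩ bif k.2 then Γ else Γᶜ)).toReal) ≤
      ∑' j, ENNReal.ofReal (negMulLog (ν (c ⁻¹' {j})).toReal) +
        ENNReal.ofReal (binEntropy (ν Γ).toReal) := by
  set q : κ → ℝ := fun j => ν.real (c ⁻¹' {j} ∩ Γ)
  set p : κ → ℝ := fun j => ν.real (c ⁻¹' {j} ∩ Γᶜ)
  have hle : ∀ A : Set X, 0 ≤ negMulLog (ν.real A) := fun A =>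
    negMulLog_nonneg measureReal_nonneg measureReal_le_one
  have hadd : ∀ j, q j + p j = ν.real (c ⁻¹' {j}) := fun j =>
    measureReal_inter_add_sdiff (μ := ν) (s := c ⁻¹' {j}) hΓ
  have hsum : ∀ A : Set X, MeasurableSet A → ∑ j, ν.real (c ⁻¹' {j} ∩ A) = ν.real A := by
    intro A hA
    rw [← measureReal_iUnion_fintype, ← Set.iUnion_inter, ← Set.preimage_iUnion,
      Set.iUnion_of_singleton, Set.preimage_univ, Set.univ_inter]
    · exact fun m n hmn => (Disjoint.preimage c (Set.disjoint_singleton.2 hmn)).mono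
        Set.inter_subset_left Set.inter_subset_left
    · exact fun j => (hc (measurableSet_singleton j)).inter hA
  have hone : ∑ j, (q j + p j) = 1 := by
    rw [Finset.sum_congr rfl fun j _ => hadd j]
    simpa using hsum Set.univ MeasurableSet.univ
  have key := sum_negMulLog_add_le (p := p) (q := q) (fun _ => measureReal_nonneg)
    (fun _ => measureReal_nonneg) hone
  simp only [hadd] at key
  rw [hsum Γ hΓ] at key
  rw [tsum_fintype, tsum_fintype, Fintype.sum_prod_type]
  simp only [Fintype.sum_bool, cond_true, cond_false, ← measureReal_def]
  rw [← ENNReal.ofReal_sum_of_nonneg fun j _ => hle _,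
    ← ENNReal.ofReal_add (Finset.sum_nonneg fun j _ => hle _)
      (binEntropy_nonneg measureReal_nonneg measureReal_le_one)]
  simp_rw [← ENNReal.ofReal_add (hle _) (hle _)]
  rw [← ENNReal.ofReal_sum_of_nonneg fun j _ => add_nonneg (hle _) (hle _)]
  exact ENNReal.ofReal_le_ofReal key

section ConditionalEntropy

variable {X : Type*} {F : MeasurableSpace X} [mX : MeasurableSpace X] [StandardBorelSpace X]
  {μ : Measure X} [IsProbabilityMeasure μ] (hF : F ≤ mX)
include hF

lemma lintegral_condExpKernel_apply {E : Set X} (hE : MeasurableSet E) :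
    ∫⁻ x, condExpKernel μ F x E ∂μ = μ E := by
  conv_rhs => rw [← condExpKernel_comp_trim (μ := μ) hF, Measure.bind_apply hE
    (condExpKernel μ F).aemeasurable]
  rw [lintegral_trim hF (measurable_condExpKernel hE)]

lemma condExpKernel_inter_ae_eq {E S : Set X} (hE : MeasurableSet E) (hS : MeasurableSet[F] S) :
    ∀ᵐ x ∂μ, condExpKernel μ F x (E ∩ S) = S.indicator (fun x => condExpKernel μ F x E) x := by
  have h1 := condExpKernel_ae_eq_condExp (μ := μ) hF (hE.inter (hF _ hS))
  have h2 := condExpKernel_ae_eq_condExp (μ := μ) hF hE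
  have h3 : μ[S.indicator (E.indicator fun _ => (1 : ℝ)) | F] =ᵐ[μ] S.indicator (μ⟦E | F⟧) :=
    condExp_indicator ((integrable_const 1).indicator hE) hS
  rw [Set.indicator_indicator, Set.inter_comm] at h3
  filter_upwards [h1, h2, h3] with x h1 h2 h3
  rw [h3] at h1
  by_cases hx : x ∈ S
  · rw [Set.indicator_of_mem hx, ← h2] at h1
    rw [Set.indicator_of_mem hx]
    exact (measureReal_eq_measureReal_iff).1 h1
  · rw [Set.indicator_of_notMem hx] at h1
    rw [Set.indicator_of_notMem hx]
    exact (measureReal_eq_zero_iff).1 h1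

lemma condPartitionEntropy_eq_lintegral {ι : Type*} [Countable ι] {A : ι → Set X}
    (hA : ∀ i, MeasurableSet (A i)) :
    condPartitionEntropy μ F A =
      ∫⁻ x, ∑' i, ENNReal.ofReal (negMulLog (condExpKernel μ F x (A i)).toReal) ∂μ := by
  refine lintegral_congr_ae ?_
  filter_upwards [ae_all_iff.2 fun i => condExpKernel_ae_eq_condExp (μ := μ) hF (hA i)] with x hx
  refine tsum_congr fun i => ?_
  rw [← hx i]
  rfl

lemma measurable_tsum_negMulLog_condExpKernel {ι : Type*} [Countable ι] {A : ι → Set X}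
    (hA : ∀ i, MeasurableSet (A i)) :
    Measurable fun x =>
      ∑' i, ENNReal.ofReal (negMulLog (condExpKernel μ F x (A i)).toReal) := by
  refine Measurable.tsum fun i => ?_
  refine ENNReal.measurable_ofReal.comp (continuous_negMulLog.measurable.comp ?_)
  exact ((measurable_condExpKernel (hA i)).mono hF le_rfl).ennreal_toReal

/-- The `F`-conditional distribution of a function of the form `x ↦ c (f x) x`, where each `c n`
is `F`-measurable. -/
lemma condExpKernel_relabel {ι κ : Type*} [Countable ι] [Countable κ]
    [MeasurableSpace ι] [MeasurableSingletonClass ι] [MeasurableSpace κ]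
    [MeasurableSingletonClass κ] {f : X → ι} (hf : Measurable f)
    {c : ι → X → κ} (hc : ∀ n, Measurable[F] (c n)) :
    ∀ᵐ x ∂μ, ∀ j, condExpKernel μ F x {y | c (f y) y = j} =
      ∑' n, {n | c n x = j}.indicator (fun n => condExpKernel μ F x (f ⁻¹' {n})) n := by
  classical
  have hmeas : ∀ n j, MeasurableSet[F] (c n ⁻¹' {j}) := fun n j =>
    hc n (measurableSet_singleton j)
  filter_upwards [ae_all_iff.2 fun n => ae_all_iff.2 fun j => condExpKernel_inter_ae_eq (μ := μ)
    hF (hf (measurableSet_singleton n)) (hmeas n j)] with x hx j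
  have hU : {y | c (f y) y = j} = ⋃ n, f ⁻¹' {n} ∩ c n ⁻¹' {j} := by
    ext y
    simp
  rw [hU, measure_iUnion]
  · refine tsum_congr fun n => ?_
    rw [hx n j]
    by_cases h : c n x = j
    · rw [Set.indicator_of_mem (by exact h), Set.indicator_of_mem (by exact h)]
    · rw [Set.indicator_of_notMem (by exact h), Set.indicator_of_notMem (by exact h)]
  · intro m n hmn
    refine Set.disjoint_left.2 fun y hy hy' => hmn ?_
    exact (Set.mem_singleton_iff.1 hy.1).symm.trans (Set.mem_singleton_iff.1 hy'.1)
  · exact fun n => (hf (measurableSet_singleton n)).inter (hF _ (hmeas n j))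

lemma tsum_negMulLog_relabel_le {ι κ : Type*} [Countable ι] [Countable κ]
    [MeasurableSpace ι] [MeasurableSingletonClass ι] [MeasurableSpace κ]
    [MeasurableSingletonClass κ] {f : X → ι} (hf : Measurable f)
    {c : ι → X → κ} (hc : ∀ n, Measurable[F] (c n)) :
    ∀ᵐ x ∂μ, ∑' j, ENNReal.ofReal
        (negMulLog (condExpKernel μ F x {y | c (f y) y = j}).toReal) ≤
      ∑' n, ENNReal.ofReal (negMulLog (condExpKernel μ F x (f ⁻¹' {n})).toReal) := by
  filter_upwards [condExpKernel_relabel (μ := μ) hF hf hc] with x hx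
  rw [← tsum_tsum_indicator_fiber (fun n => c n x) fun _ n =>
    ENNReal.ofReal (negMulLog (condExpKernel μ F x (f ⁻¹' {n})).toReal)]
  refine ENNReal.tsum_le_tsum fun j => ?_
  rw [hx j]
  refine (ofReal_negMulLog_tsum_le ?_).trans (le_of_eq (tsum_congr fun n => ?_))
  · rw [← hx j]
    exact prob_le_one
  · by_cases h : c n x = j
    · rw [Set.indicator_of_mem (by exact h), Set.indicator_of_mem (by exact h)]
    · rw [Set.indicator_of_notMem (by exact h), Set.indicator_of_notMem (by exact h)]
      simp

lemma lintegral_binEntropy_condExpKernel_le {Γ : Set X} (hΓ : MeasurableSet Γ) :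
    ∫⁻ x, ENNReal.ofReal (binEntropy (condExpKernel μ F x Γ).toReal) ∂μ ≤
      ENNReal.ofReal (binEntropy (μ Γ).toReal) := by
  have hmem : ∀ x, (condExpKernel μ F x Γ).toReal ∈ Set.Icc (0 : ℝ) 1 := fun x =>
    ⟨ENNReal.toReal_nonneg, measureReal_le_one⟩
  have hmeas : Measurable fun x => (condExpKernel μ F x Γ).toReal :=
    ((measurable_condExpKernel hΓ).mono hF le_rfl).ennreal_toReal
  have hκ : Integrable (fun x => (condExpKernel μ F x Γ).toReal) μ :=
    integrable_toReal_condExpKernel hΓ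
  have hnn : ∀ x, 0 ≤ binEntropy (condExpKernel μ F x Γ).toReal := fun x =>
    binEntropy_nonneg (hmem x).1 (hmem x).2
  have hκb : Integrable (fun x => binEntropy (condExpKernel μ F x Γ).toReal) μ := by
    refine Integrable.of_bound
      (binEntropy_continuous.measurable.comp hmeas).aestronglyMeasurable (Real.log 2) ?_
    refine .of_forall fun x => ?_
    rw [Real.norm_of_nonneg (hnn x)]
    exact binEntropy_le_log_two
  rw [← ofReal_integral_eq_lintegral_ofReal hκb (.of_forall hnn)]
  refine ENNReal.ofReal_le_ofReal ?_
  have h := strictConcave_binEntropy.concaveOn.le_map_integral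
    binEntropy_continuous.continuousOn isClosed_Icc (.of_forall hmem) hκ hκb
  rw [integral_toReal ((measurable_condExpKernel hΓ).mono hF le_rfl).aemeasurable
    (.of_forall fun x => measure_lt_top _ _), lintegral_condExpKernel_apply hF hΓ] at h
  exact h

end ConditionalEntropy

section SigmaAlgebras

variable {X G : Type*} [Group G] [MulAction G X]

lemma IsInvariantAlg.sup {M N : MeasurableSpace X} (hM : IsInvariantAlg G M)
    (hN : IsInvariantAlg G N) : IsInvariantAlg G (M ⊔ N) := by
  intro S hS g
  have h : M ⊔ N ≤ (M ⊔ N).map fun x => g • x :=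
    sup_le (fun T hT => (le_sup_left : M ≤ M ⊔ N) _ (hM T hT g))
      fun T hT => (le_sup_right : N ≤ M ⊔ N) _ (hN T hT g)
  exact h S hS

lemma IsInvariantAlg.inf {M N : MeasurableSpace X} (hM : IsInvariantAlg G M)
    (hN : IsInvariantAlg G N) : IsInvariantAlg G (M ⊓ N) := by
  intro S hS g
  obtain ⟨h₁, h₂⟩ := MeasurableSpace.measurableSet_inf.1 hS
  exact MeasurableSpace.measurableSet_inf.2 ⟨hM S h₁ g, hN S h₂ g⟩

variable {mX : MeasurableSpace X} {μ : Measure X} {C : Set (Set X)}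

lemma measurableSet_sigmaG_of_mem {S : Set X} (hS : S ∈ C) : MeasurableSet[sigmaG G μ C] S :=
  MeasurableSpace.measurableSet_sInf.2 fun _ hm => hm.1 S hS

lemma measurableSet_sigmaG_of_null {S : Set X} (hS : μ S = 0) : MeasurableSet[sigmaG G μ C] S :=
  MeasurableSpace.measurableSet_sInf.2 fun _ hm => hm.2.2 S hS

lemma isInvariantAlg_sigmaG : IsInvariantAlg G (sigmaG G μ C) := fun S hS g =>
  MeasurableSpace.measurableSet_sInf.2 fun m hm =>
    hm.2.1 S (MeasurableSpace.measurableSet_sInf.1 hS m hm) g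

lemma sigmaG_le {N : MeasurableSpace X} (hC : ∀ S ∈ C, MeasurableSet[N] S)
    (hN : IsInvariantAlg G N) (hnull : ∀ S : Set X, μ S = 0 → MeasurableSet[N] S) :
    sigmaG G μ C ≤ N :=
  sInf_le ⟨hC, hN, hnull⟩

end SigmaAlgebras

/-- In an ergodic system, an integer label `ℓ` whose binary length has finite mean can be
recovered from a truncation of `ℓ` together with a set of small measure. -/
theorem exists_coding_set_of_label {X G : Type*} {M : MeasurableSpace X} [mX : MeasurableSpace X]
    [Group G] [Countable G] [MulAction G X] {μ : Measure X} [IsProbabilityMeasure μ]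
    (hpmp : IsPmpAction G μ) (herg : IsErgodicAction G μ)
    (hMle : M ≤ mX) (hM : IsInvariantAlg G M) {ℓ : X → ℕ}
    (hℓ : Measurable[M] ℓ) (hsum : ∑' j, μ (ℓ ⁻¹' {j}) * j.size ≠ ⊤) {δ : ℝ≥0∞} (hδ : 0 < δ) :
    ∃ (n : ℕ) (Γ : Set X), MeasurableSet[M] Γ ∧ μ Γ ≤ δ ∧
      ∀ N : MeasurableSpace X, IsInvariantAlg G N → (∀ S : Set X, μ S = 0 → MeasurableSet[N] S) →
        MeasurableSet[N] Γ → (∀ j ≤ n, MeasurableSet[N] {x | min (ℓ x) n = j}) →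
        ∀ j, MeasurableSet[N] (ℓ ⁻¹' {j}) := by
  have htail := ENNReal.tendsto_sum_nat_add (fun j => μ (ℓ ⁻¹' {j}) * (j.size : ℝ≥0∞)) hsum
  have hpos : (0 : ℝ≥0∞) < min δ 1 / 2 :=
    ENNReal.div_pos (lt_min hδ zero_lt_one).ne' ENNReal.ofNat_ne_top
  obtain ⟨n, hn, hn1⟩ := ((htail.eventually (ge_mem_nhds hpos)).and
    (Filter.eventually_ge_atTop 1)).exists
  set T : ℕ → Set X := fun i => {x | n ≤ ℓ x ∧ 2 ^ i ≤ ℓ x} with hT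
  have hlab : ∀ P : ℕ → Prop, MeasurableSet[M] {x | P (ℓ x)} := fun P =>
    hℓ (MeasurableSet.of_discrete (s := {k | P k}))
  have hTsum : ∑' i, μ (T i) ≤ min δ 1 / 2 := by
    refine le_trans ?_ hn
    calc ∑' i, μ (T i)
        ≤ ∑' i, ∑' k, if i < (k + n).size then μ (ℓ ⁻¹' {k + n}) else 0 := by
          refine ENNReal.tsum_le_tsum fun i => ?_
          have : T i ⊆ ⋃ k, if i < (k + n).size then ℓ ⁻¹' {k + n} else ∅ := by
            rintro x ⟨hx1, hx2⟩
            refine Set.mem_iUnion.2 ⟨ℓ x - n, ?_⟩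
            rw [Nat.sub_add_cancel hx1, if_pos (Nat.lt_size.2 hx2)]
            rfl
          refine (measure_mono this).trans ((measure_iUnion_le _).trans
            (ENNReal.tsum_le_tsum fun k => ?_))
          split_ifs <;> simp
      _ = ∑' k, ∑' i, if i < (k + n).size then μ (ℓ ⁻¹' {k + n}) else 0 := ENNReal.tsum_comm
      _ = ∑' k, μ (ℓ ⁻¹' {k + n}) * ((k + n).size : ℝ≥0∞) := by
          refine tsum_congr fun k => ?_
          rw [tsum_eq_sum (s := Finset.range (k + n).size)
            fun i hi => if_neg (by simpa using hi),
            Finset.sum_congr rfl fun i hi => if_pos (Finset.mem_range.1 hi)]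
          simp [mul_comm]
  set U : ℕ → Set X := fun i => T i.div2 with hUdef
  set E : ℕ → Set X := fun i =>
    bif i.bodd then {x | n ≤ ℓ x ∧ (ℓ x).testBit i.div2 = true} else T (i.div2 + 1) with hEdef
  have hUsum : ∑' i, μ (U i) ≤ min δ 1 := by
    rw [← Equiv.boolProdNatEquivNat.tsum_eq, ENNReal.tsum_prod', tsum_bool]
    have : ∀ b k, U (Equiv.boolProdNatEquivNat (b, k)) = T k := fun b k => by
      simp [hUdef, Equiv.boolProdNatEquivNat]
    simp only [this]
    exact (add_le_add hTsum hTsum).trans_eq (ENNReal.add_halves _)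
  obtain ⟨Γ, hΓM, hΓμ, hΓ⟩ := exists_coding_set hpmp herg hMle hM (U := U) (E := E)
    (fun i => hlab fun k => n ≤ k ∧ 2 ^ i.div2 ≤ k)
    (fun i => by
      simp only [hEdef]
      cases i.bodd
      · exact hlab fun k => n ≤ k ∧ 2 ^ (i.div2 + 1) ≤ k
      · exact hlab fun k => n ≤ k ∧ k.testBit i.div2 = true)
    (fun i => by
      simp only [hEdef, hUdef]
      cases i.bodd
      · exact fun x hx => ⟨hx.1, (Nat.pow_le_pow_right two_pos (Nat.le_succ _)).trans hx.2⟩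
      · exact fun x hx => ⟨hx.1, Nat.ge_two_pow_of_testBit hx.2⟩)
    (hUsum.trans (min_le_right _ _))
  refine ⟨n, Γ, hΓM, hΓμ.trans (hUsum.trans (min_le_left _ _)), ?_⟩
  intro N hN hnull hΓN htrunc
  have htop : MeasurableSet[N] {x | n ≤ ℓ x} := by
    simpa only [min_eq_right_iff] using htrunc n le_rfl
  have hEN : ∀ i, MeasurableSet[N] (E i) := by
    refine hΓ N hN hnull hΓN fun i hi => ?_
    simp only [hUdef]
    rcases Nat.eq_zero_or_pos i.div2 with h0 | h0
    · have : T i.div2 = {x | n ≤ ℓ x} := by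
        ext x
        simp only [hT, h0, pow_zero, Set.mem_ofPred_eq, and_iff_left_iff_imp]
        exact hn1.trans
      rw [this]
      exact htop
    · have h := hi (Nat.bit false (i.div2 - 1)) (by
        have := Nat.div2_val i
        rw [Nat.bit_false_apply]
        omega)
      simpa [hEdef, Nat.sub_add_cancel h0] using h
  have hbit : ∀ i, MeasurableSet[N] {x | n ≤ ℓ x ∧ (ℓ x).testBit i = true} := fun i => by
    simpa [hEdef] using hEN (Nat.bit true i)
  intro j
  rcases lt_or_ge j n with hj | hj
  · have : ℓ ⁻¹' {j} = {x | min (ℓ x) n = j} := by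
      ext x
      simp only [Set.mem_preimage, Set.mem_singleton_iff, Set.mem_ofPred_eq]
      omega
    rw [this]
    exact htrunc j hj.le
  · have : ℓ ⁻¹' {j} = {x | n ≤ ℓ x} ∩ ⋂ i,
        if j.testBit i then {x | n ≤ ℓ x ∧ (ℓ x).testBit i = true}
        else {x | n ≤ ℓ x ∧ (ℓ x).testBit i = true}ᶜ := by
      ext x
      simp only [Set.mem_preimage, Set.mem_singleton_iff, Set.mem_inter_iff, Set.mem_ofPred_eq,
        Set.mem_iInter]
      constructor
      · rintro rfl
        refine ⟨hj, fun i => ?_⟩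
        by_cases h : (ℓ x).testBit i <;> simp [h, hj]
      · rintro ⟨hx, h⟩
        refine Nat.eq_of_testBit_eq fun i => ?_
        have hi := h i
        by_cases hb : j.testBit i
        · rw [if_pos hb] at hi
          rw [hb]
          exact hi.2
        · rw [if_neg hb] at hi
          simp only [Bool.not_eq_true] at hb
          rw [hb]
          by_contra hne
          exact hi ⟨hx, by simpa using hne⟩
    rw [this]
    refine htop.inter (MeasurableSet.iInter fun i => ?_)
    split_ifs
    · exact hbit i
    · exact (hbit i).compl

section ConditionalRank

variable {X : Type*} {F M : MeasurableSpace X} [mX : MeasurableSpace X] [StandardBorelSpace X]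
  {μ : Measure X} [IsProbabilityMeasure μ]

lemma measure_inter_condExpKernel_eq_zero (hF : F ≤ mX) {E : Set X} (hE : MeasurableSet E) :
    μ (E ∩ {x | condExpKernel μ F x E = 0}) = 0 := by
  have hS : MeasurableSet[F] {x | condExpKernel μ F x E = 0} :=
    measurable_condExpKernel hE (measurableSet_singleton 0)
  rw [← lintegral_condExpKernel_apply hF (hE.inter (hF _ hS)),
    lintegral_congr_ae (condExpKernel_inter_ae_eq hF hE hS)]
  refine (lintegral_congr fun x => ?_).trans lintegral_zero
  by_cases hx : condExpKernel μ F x E = 0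
  · rw [Set.indicator_of_mem (by exact hx), hx]
  · rw [Set.indicator_of_notMem (by exact hx)]

/-- The rank of the value `n` when the values of `f` are listed by decreasing `F`-conditional
probability at the point `x`. -/
noncomputable def condRank {X : Type*} [mX : MeasurableSpace X] [StandardBorelSpace X]
    (μ : Measure X) [IsProbabilityMeasure μ] (F : MeasurableSpace X) (f : X → ℕ) (n : ℕ) (x : X) :
    ℕ :=
  sortedRank (fun m => @condExpKernel X mX _ μ _ F x (f ⁻¹' {m})) n

variable {f : X → ℕ}

lemma measurable_condRank (hf : Measurable f) (n : ℕ) : Measurable[F] (condRank μ F f n) :=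
  measurable_sortedRank (fun m => measurable_condExpKernel (hf (measurableSet_singleton m))) n

lemma tsum_condExpKernel_fiber (hf : Measurable f) (x : X) :
    ∑' m, condExpKernel μ F x (f ⁻¹' {m}) = 1 :=
  tsum_measure_fiber hf _

lemma measurable_condRank_self (hFM : F ≤ M) (hM : M ≤ mX)
    (hf : Measurable[M] f) : Measurable[M] fun x => condRank μ F f (f x) x := by
  refine @measurable_to_countable' _ _ _ _ M _ fun j => ?_
  have : (fun x => condRank μ F f (f x) x) ⁻¹' {j} =
      ⋃ n, f ⁻¹' {n} ∩ condRank μ F f n ⁻¹' {j} := by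
    ext y
    simp
  rw [this]
  exact MeasurableSet.iUnion fun n => (hf (measurableSet_singleton n)).inter
    (hFM _ (measurable_condRank (hf.mono hM le_rfl) n (measurableSet_singleton j)))

lemma tsum_measure_mul_size_condRank_le (hF : F ≤ mX) (hf : Measurable f) :
    ∑' j : ℕ, μ ((fun x => condRank μ F f (f x) x) ⁻¹' {j}) * j.size ≤
      1 + 2 * ∫⁻ x, ∑' n,
        ENNReal.ofReal (negMulLog (condExpKernel μ F x (f ⁻¹' {n})).toReal) ∂μ := by
  have hmeas : ∀ j, MeasurableSet ((fun x => condRank μ F f (f x) x) ⁻¹' {j}) := fun j =>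
    measurable_condRank_self hF le_rfl hf (measurableSet_singleton j)
  have hm : ∀ j, Measurable fun x =>
      condExpKernel μ F x ((fun x => condRank μ F f (f x) x) ⁻¹' {j}) := fun j =>
    (measurable_condExpKernel (hmeas j)).mono hF le_rfl
  calc ∑' j : ℕ, μ ((fun x => condRank μ F f (f x) x) ⁻¹' {j}) * j.size
      = ∫⁻ x, ∑' j : ℕ, condExpKernel μ F x ((fun x => condRank μ F f (f x) x) ⁻¹' {j}) *
          j.size ∂μ := by
        rw [lintegral_tsum fun j => ((hm j).mul_const _).aemeasurable]
        refine tsum_congr fun j => ?_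
        rw [lintegral_mul_const _ (hm j), lintegral_condExpKernel_apply hF (hmeas j)]
    _ ≤ ∫⁻ x, 1 + 2 * ∑' n,
          ENNReal.ofReal (negMulLog (condExpKernel μ F x (f ⁻¹' {n})).toReal) ∂μ := by
        refine lintegral_mono_ae ?_
        filter_upwards [condExpKernel_relabel (μ := μ) hF hf fun n =>
          measurable_condRank (μ := μ) (F := F) hf n] with x hx
        have h1 := tsum_condExpKernel_fiber (μ := μ) (F := F) hf x
        rw [← h1, ← ENNReal.tsum_mul_left, ← ENNReal.tsum_add]
        refine le_trans (le_of_eq ?_) (ENNReal.tsum_le_tsum fun n =>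
          mul_size_sortedRank_le h1.le n)
        refine Eq.trans (tsum_congr fun j => ?_) (tsum_tsum_indicator_fiber
          (fun n => condRank μ F f n x)
          fun j n => condExpKernel μ F x (f ⁻¹' {n}) * (j.size : ℝ≥0∞))
        rw [show (fun x => condRank μ F f (f x) x) ⁻¹' {j} = {y | condRank μ F f (f y) y = j}
          from rfl, hx j, ← ENNReal.tsum_mul_right]
        refine tsum_congr fun n => ?_
        by_cases h : condRank μ F f n x = j
        · rw [Set.indicator_of_mem (by exact h), Set.indicator_of_mem (by exact h)]
        · rw [Set.indicator_of_notMem (by exact h), Set.indicator_of_notMem (by exact h), zero_mul]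
    _ = _ := by
        have hmeasH := measurable_tsum_negMulLog_condExpKernel (μ := μ) hF fun n =>
          hf (measurableSet_singleton n)
        rw [lintegral_add_left measurable_const, lintegral_const_mul _ hmeasH, lintegral_const,
          measure_univ, one_mul]

/-- Modulo null sets, a function is determined by its conditional rank together with `F`. -/
lemma measurableSet_fiber_of_condRank (hF : F ≤ mX) (hf : Measurable f)
    (hnull : ∀ S : Set X, μ S = 0 → MeasurableSet[M] S) (hFM : F ≤ M)
    (h : ∀ j, MeasurableSet[M] ((fun x => condRank μ F f (f x) x) ⁻¹' {j})) (k : ℕ) :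
    MeasurableSet[M] (f ⁻¹' {k}) := by
  have hfm : ∀ n, MeasurableSet (f ⁻¹' {n}) := fun n => hf (measurableSet_singleton n)
  have hT : MeasurableSet[M] ({x | condExpKernel μ F x (f ⁻¹' {k}) = 0}ᶜ ∩
      ⋃ j, (fun x => condRank μ F f (f x) x) ⁻¹' {j} ∩ condRank μ F f k ⁻¹' {j}) := by
    refine MeasurableSet.inter (MeasurableSet.compl (hFM _ ?_))
      (MeasurableSet.iUnion fun j => (h j).inter (hFM _ ?_))
    · exact measurable_condExpKernel (hfm k) (measurableSet_singleton 0)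
    · exact measurable_condRank hf k (measurableSet_singleton j)
  refine measurableSet_of_null_symmDiff hnull hT ?_ ?_
  · refine measure_mono_null ?_ (measure_inter_condExpKernel_eq_zero hF (hfm k))
    rintro x ⟨rfl, hx⟩
    refine ⟨rfl, ?_⟩
    by_contra hne
    exact hx ⟨hne, Set.mem_iUnion.2 ⟨_, rfl, rfl⟩⟩
  · refine measure_mono_null ?_ (measure_iUnion_null fun n =>
      measure_inter_condExpKernel_eq_zero (μ := μ) hF (hfm n))
    rintro x ⟨⟨hk, hx⟩, hxk⟩
    obtain ⟨j, hj, hj'⟩ := Set.mem_iUnion.1 hx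
    refine Set.mem_iUnion.2 ⟨f x, rfl, ?_⟩
    by_contra hne
    exact hxk (eq_of_sortedRank_eq (tsum_condExpKernel_fiber hf x).le hne hk (hj.trans hj'.symm))

end ConditionalRank

lemma exists_pos_binEntropy_lt {ε : ℝ} (hε : 0 < ε) :
    ∃ δ : ℝ≥0∞, 0 < δ ∧ ∀ t ≤ δ, binEntropy t.toReal < ε := by
  have h : Filter.Tendsto (fun t : ℝ≥0∞ => binEntropy t.toReal) (nhds 0) (nhds 0) := by
    have h1 := (binEntropy_continuous.tendsto _).comp (ENNReal.tendsto_toReal ENNReal.zero_ne_top)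
    rwa [ENNReal.toReal_zero, binEntropy_zero] at h1
  obtain ⟨δ, hδ, hsub⟩ := ENNReal.nhds_zero_basis_Iic.eventually_iff.1
    (h.eventually (gt_mem_nhds hε))
  exact ⟨δ, hδ, fun t ht => hsub ht⟩

/-- Finite replacement for the fibers of an integer-valued function, relative to an invariant
σ-algebra `M` for which the function is measurable. -/
theorem exists_finite_partition_of_fiber {X G : Type*} {F M : MeasurableSpace X}
    [mX : MeasurableSpace X] [StandardBorelSpace X] [Group G] [Countable G] [MulAction G X]
    {μ : Measure X} [IsProbabilityMeasure μ] (hpmp : IsPmpAction G μ)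
    (herg : IsErgodicAction G μ) (hFM : F ≤ M) (hMle : M ≤ mX) (hM : IsInvariantAlg G M)
    {f : X → ℕ} (hf : Measurable[M] f)
    (hfin : condPartitionEntropy μ F (fun n => f ⁻¹' {n}) ≠ ⊤) {ε : ℝ} (hε : 0 < ε) :
    ∃ (m : ℕ) (A : Fin m → Set X), (∀ i, MeasurableSet[M] (A i)) ∧
      Pairwise (Function.onFun Disjoint A) ∧ ⋃ i, A i = Set.univ ∧
      (∀ N : MeasurableSpace X, IsInvariantAlg G N →
        (∀ S : Set X, μ S = 0 → MeasurableSet[N] S) → F ≤ N → (∀ i, MeasurableSet[N] (A i)) →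
        ∀ n, MeasurableSet[N] (f ⁻¹' {n})) ∧
      condPartitionEntropy μ F A <
        condPartitionEntropy μ F (fun n => f ⁻¹' {n}) + ENNReal.ofReal ε := by
  have hF : F ≤ mX := hFM.trans hMle
  have hfX : Measurable f := hf.mono hMle le_rfl
  have hent := condPartitionEntropy_eq_lintegral (μ := μ) hF fun n =>
    hfX (measurableSet_singleton n)
  set ℓ : X → ℕ := fun x => condRank μ F f (f x) x with hℓdef
  have hℓ : Measurable[M] ℓ := measurable_condRank_self hFM hMle hf
  have hsum : ∑' j, μ (ℓ ⁻¹' {j}) * j.size ≠ ⊤ := by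
    refine ne_top_of_le_ne_top ?_ (tsum_measure_mul_size_condRank_le hF hfX)
    rw [← hent]
    exact ENNReal.add_ne_top.2 ⟨one_ne_top, ENNReal.mul_ne_top ofNat_ne_top hfin⟩
  obtain ⟨δ, hδ, hδε⟩ := exists_pos_binEntropy_lt hε
  obtain ⟨n, Γ, hΓM, hΓδ, hrec⟩ := exists_coding_set_of_label hpmp herg hMle hM hℓ hsum hδ
  set r : ℕ → Fin (n + 1) := fun k => ⟨min k n, Nat.lt_succ_of_le (min_le_right _ _)⟩ with hr
  set B : Fin (n + 1) × Bool → Set X := fun k =>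
    (fun x => r (ℓ x)) ⁻¹' {k.1} ∩ bif k.2 then Γ else Γᶜ with hB
  have hrM : Measurable[M] fun x => r (ℓ x) := (measurable_from_nat (f := r)).comp hℓ
  have hBM : ∀ k, MeasurableSet[M] (B k) := by
    rintro ⟨j, b⟩
    refine MeasurableSet.inter (hrM (measurableSet_singleton j)) ?_
    cases b
    exacts [hΓM.compl, hΓM]
  let e := (Fintype.equivFin (Fin (n + 1) × Bool)).symm
  refine ⟨_, fun i => B (e i), fun i => hBM _, ?_, ?_, ?_, ?_⟩
  · intro i i' hii
    refine Set.disjoint_left.2 fun x hx hx' => hii (e.injective (Prod.ext ?_ ?_))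
    · exact hx.1.symm.trans hx'.1
    · have h1 := hx.2
      have h2 := hx'.2
      cases hb : (e i).2 <;> cases hb' : (e i').2 <;> simp_all
  · refine Set.eq_univ_of_forall fun x => ?_
    by_cases hx : x ∈ Γ
    · exact Set.mem_iUnion.2 ⟨e.symm (r (ℓ x), true), by simp [hB, hx]⟩
    · exact Set.mem_iUnion.2 ⟨e.symm (r (ℓ x), false), by simp [hB, hx]⟩
  · intro N hN hnull hFN hA
    have hBN : ∀ k, MeasurableSet[N] (B k) := fun k => by simpa using hA (e.symm k)
    refine @measurableSet_fiber_of_condRank X F N mX _ μ _ f hF hfX hnull hFN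
      (hrec N hN hnull ?_ fun j hj => ?_)
    · have : Γ = ⋃ j, B (j, true) := by
        ext x
        simp [hB]
      rw [this]
      exact MeasurableSet.iUnion fun j => hBN _
    · have : {x | min (ℓ x) n = j} = ⋃ b, B (⟨j, Nat.lt_succ_of_le hj⟩, b) := by
        ext x
        by_cases hx : x ∈ Γ <;> simp [hB, hr, hx]
      rw [this]
      exact MeasurableSet.iUnion fun b => hBN _
  · have hΓX := hMle _ hΓM
    rw [condPartitionEntropy_eq_lintegral hF fun i => hMle _ (hBM (e i))]
    calc ∫⁻ x, ∑' i, ENNReal.ofReal (negMulLog (condExpKernel μ F x (B (e i))).toReal) ∂μ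
        = ∫⁻ x, ∑' k, ENNReal.ofReal (negMulLog (condExpKernel μ F x (B k)).toReal) ∂μ :=
          lintegral_congr fun x => e.tsum_eq fun k =>
            ENNReal.ofReal (negMulLog (condExpKernel μ F x (B k)).toReal)
      _ ≤ ∫⁻ x, ∑' k, ENNReal.ofReal (negMulLog (condExpKernel μ F x (f ⁻¹' {k})).toReal) +
            ENNReal.ofReal (binEntropy (condExpKernel μ F x Γ).toReal) ∂μ := by
          refine lintegral_mono_ae ?_
          filter_upwards [tsum_negMulLog_relabel_le (μ := μ) hF hfX (c := fun k x =>
            r (condRank μ F f k x)) fun k =>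
              (measurable_from_nat (f := r)).comp (measurable_condRank hfX k)] with x hx
          exact (tsum_negMulLog_refine_le (hrM.mono hMle le_rfl) hΓX _).trans
            (add_le_add_left hx _)
      _ ≤ condPartitionEntropy μ F (fun n => f ⁻¹' {n}) +
            ENNReal.ofReal (binEntropy (μ Γ).toReal) := by
          rw [hent, lintegral_add_left (measurable_tsum_negMulLog_condExpKernel hF fun k =>
            hfX (measurableSet_singleton k))]
          gcongr
          exact lintegral_binEntropy_condExpKernel_le hF hΓX
      _ < _ := ENNReal.add_lt_add_left hfin
          ((ENNReal.ofReal_lt_ofReal_iff hε).2 (hδε _ hΓδ))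

lemma exists_nat_fiber_of_isPartition {X : Type*} {_ : MeasurableSpace X} {μ : Measure X}
    {ξ : ℕ → Set X} (hξ : IsPartition μ ξ) :
    ∃ f : X → ℕ, ∀ n, f ⁻¹' {n} = ξ n ∨ f ⁻¹' {n} = ξ n ∪ (⋃ i, ξ i)ᶜ := by
  classical
  have hval : ∀ (n : ℕ) (x : X), x ∈ ξ n → ∀ h : ∃ k, x ∈ ξ k, h.choose = n := fun n x hx h => by
    by_contra hne
    exact Set.disjoint_left.1 (hξ.2.1 hne) h.choose_spec hx
  refine ⟨fun x => if h : ∃ k, x ∈ ξ k then h.choose else 0, fun n => ?_⟩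
  rcases Nat.eq_zero_or_pos n with rfl | hn
  · refine Or.inr (Set.ext fun x => ?_)
    by_cases h : ∃ k, x ∈ ξ k
    · have hx : x ∈ ⋃ i, ξ i := Set.mem_iUnion.2 h
      simp only [Set.mem_preimage, Set.mem_singleton_iff, dif_pos h, Set.mem_union,
        Set.mem_compl_iff, hx, not_true_eq_false, or_false]
      exact ⟨fun h0 => h0 ▸ h.choose_spec, fun h0 => hval 0 x h0 h⟩
    · have hx : x ∉ ⋃ i, ξ i := fun h' => h (Set.mem_iUnion.1 h')
      exact iff_of_true (by simp [dif_neg h]) (Or.inr hx)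
  · refine Or.inl (Set.ext fun x => ?_)
    by_cases h : ∃ k, x ∈ ξ k
    · simp only [Set.mem_preimage, Set.mem_singleton_iff, dif_pos h]
      exact ⟨fun h0 => h0 ▸ h.choose_spec, fun h0 => hval n x h0 h⟩
    · simp only [Set.mem_preimage, Set.mem_singleton_iff, dif_neg h]
      exact ⟨fun h0 => absurd h0 hn.ne, fun h0 => absurd ⟨n, h0⟩ h⟩

lemma condPartitionEntropy_congr_ae {X ι : Type*} {F : MeasurableSpace X}
    {_ : MeasurableSpace X} {μ : Measure X} [Countable ι] {A B : ι → Set X}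
    (h : ∀ i, A i =ᵐ[μ] B i) : condPartitionEntropy μ F A = condPartitionEntropy μ F B := by
  refine lintegral_congr_ae ?_
  filter_upwards [ae_all_iff.2 fun i => condExp_congr_ae (m := F)
    (indicator_ae_eq_of_ae_eq_set (f := fun _ => (1 : ℝ)) (h i))] with x hx
  exact tsum_congr fun i => by rw [hx i]

/-- **Proposition (replacing countably infinite partitions by finite ones).**
If `ξ` is a countable Borel partition with `H(ξ | F) < ∞`, then for every
`ε > 0` there is a finite Borel partition `α` with
`σ_G(α) ∨ F = σ_G(ξ) ∨ F` (up to null sets) and `H(α | F) < H(ξ | F) + ε`. -/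
theorem finite_partition_replacement
    {X : Type*} [mX : MeasurableSpace X] [StandardBorelSpace X]
    (G : Type*) [Group G] [Countable G] [MulAction G X]
    (μ : Measure X) [IsProbabilityMeasure μ]
    (hpmp : IsPmpAction G μ) (herg : IsErgodicAction G μ)
    (F : MeasurableSpace X) (hFle : F ≤ mX) (hFinv : IsInvariantAlg G F)
    (ξ : ℕ → Set X) (hξ : IsPartition μ ξ)
    (hfin : condPartitionEntropy μ F ξ ≠ ⊤)
    (ε : ℝ) (hε : 0 < ε) :
    ∃ (m : ℕ) (A : Fin m → Set X),
      IsPartition μ A ∧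
      sigmaG G μ (Set.range A) ⊔ F = sigmaG G μ (Set.range ξ) ⊔ F ∧
      condPartitionEntropy μ F A < condPartitionEntropy μ F ξ + ENNReal.ofReal ε := by

  obtain ⟨f, hf⟩ := exists_nat_fiber_of_isPartition hξ
  set M : MeasurableSpace X := mX ⊓ (sigmaG G μ (Set.range ξ) ⊔ F)
  have hinv : ∀ C : Set (Set X), IsInvariantAlg G (sigmaG G μ C ⊔ F) := fun C =>
    isInvariantAlg_sigmaG.sup hFinv
  have hnullC : ∀ (C : Set (Set X)) (S : Set X), μ S = 0 →
      MeasurableSet[sigmaG G μ C ⊔ F] S := fun C S hS =>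
    (le_sup_left : sigmaG G μ C ≤ sigmaG G μ C ⊔ F) _ (measurableSet_sigmaG_of_null hS)
  have hmemC : ∀ (C : Set (Set X)) (S : Set X), S ∈ C →
      MeasurableSet[sigmaG G μ C ⊔ F] S := fun C S hS =>
    (le_sup_left : sigmaG G μ C ≤ sigmaG G μ C ⊔ F) _ (measurableSet_sigmaG_of_mem hS)
  have hUnull : μ (⋃ i, ξ i)ᶜ = 0 :=
    (prob_compl_eq_zero_iff (MeasurableSet.iUnion hξ.1)).2 hξ.2.2
  have hM : IsInvariantAlg G M := hpmp.isInvariantAlg.inf (hinv _)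
  have hMle : M ≤ mX := inf_le_left
  have hFM : F ≤ M := le_inf hFle le_sup_right
  have hξM : ∀ n, MeasurableSet[M] (ξ n) := fun n =>
    MeasurableSpace.measurableSet_inf.2 ⟨hξ.1 n, hmemC _ _ ⟨n, rfl⟩⟩
  have hfae : ∀ n, f ⁻¹' {n} =ᵐ[μ] ξ n := fun n => by
    rcases hf n with h | h
    · exact .of_eq h
    · rw [h]
      exact union_ae_eq_left_of_ae_eq_empty (ae_eq_empty.2 hUnull)
  have hfM : Measurable[M] f := by
    refine @measurable_to_countable' _ _ _ _ M _ fun n => ?_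
    rcases hf n with h | h
    · rw [h]
      exact hξM n
    · rw [h]
      exact (hξM n).union (MeasurableSet.iUnion hξM).compl
  have hent : condPartitionEntropy μ F (fun n => f ⁻¹' {n}) = condPartitionEntropy μ F ξ :=
    condPartitionEntropy_congr_ae hfae
  obtain ⟨m, A, hAM, hdisj, hunion, hrec, hlt⟩ :=
    @exists_finite_partition_of_fiber X G F M mX _ _ _ _ μ _ hpmp herg hFM hMle hM f hfM
      (hent ▸ hfin) ε hε
  refine ⟨m, A, ⟨fun i => hMle _ (hAM i), hdisj, ?_⟩, le_antisymm ?_ ?_, hent ▸ hlt⟩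
  · rw [hunion, measure_univ]
  · refine sup_le (sigmaG_le ?_ (hinv _) (hnullC _)) le_sup_right
    rintro _ ⟨i, rfl⟩
    exact (MeasurableSpace.measurableSet_inf.1 (hAM i)).2
  · refine sup_le (sigmaG_le ?_ (hinv _) (hnullC _)) le_sup_right
    rintro _ ⟨n, rfl⟩
    have hfn := hrec _ (hinv (Set.range A)) (hnullC _) le_sup_right
      (fun i => hmemC _ _ ⟨i, rfl⟩) n
    have h := ae_eq_set.1 (hfae n)
    exact measurableSet_of_null_symmDiff (hnullC _) hfn h.2 h.1
end

section
/- Let (X, μ) be a standard probability space, let F be a sub-σ-algebra, let π : (X, μ) → (Y, ν) be the factor map associated to F, and let μ = ∫_Y μ_y dν(y) be the disintegration of μ over ν (so μ_y(π^{-1}(y)) = 1 for ν-a.e. y). If ξ is a countable Borel partition of X with H(ξ | F) = ∫_Y Σ_{C ∈ ξ} −μ_y(C)·log μ_y(C) dν(y) < ∞, then there is a Borel function L : Y × ξ → {0,1,2}^{<ω} (finite words in a three-letter alphabet) such that for ν-almost-every y the map L(y, ·) : ξ → {0,1,2}^{<ω} is injective, and ∫_Y Σ_{C ∈ ξ} |L(y,C)|·μ_y(C)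 dν(y) < ∞, where |w| denotes the length of the word w. -/
open MeasureTheory ENNReal

/-- The ternary expansion of a natural number, least significant digit first. -/
def ternaryWord (n : ℕ) : List (Fin 3) := (Nat.digits 3 n).map (Fin.ofNat 3)

lemma ternaryWord_injective : Function.Injective ternaryWord := by
  refine Function.LeftInverse.injective
    (g := fun w => Nat.ofDigits 3 (w.map Fin.val)) fun n => ?_
  have h : ((Nat.digits 3 n).map (Fin.ofNat 3)).map Fin.val = Nat.digits 3 n := by
    rw [List.map_map]
    conv_rhs => rw [← List.map_id (Nat.digits 3 n)]
    refine List.map_congr_left fun d hd => ?_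
    have hd3 : d < 3 := Nat.digits_lt_base (by norm_num) hd
    simp [Fin.ofNat, Nat.mod_eq_of_lt hd3]
  simp only [ternaryWord, h, Nat.ofDigits_digits]

lemma length_ternaryWord_le {n : ℕ} (hn : n ≠ 0) :
    ((ternaryWord n).length : ℝ) ≤ Real.log n + 1 := by
  have hn' : (0 : ℝ) < n := by exact_mod_cast Nat.pos_of_ne_zero hn
  have hpow : (3 : ℝ) ^ Nat.log 3 n ≤ n := by
    exact_mod_cast Nat.pow_log_le_self 3 hn
  have hlog := Real.log_le_log (by positivity) hpow
  rw [Real.log_pow] at hlog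
  have h3 : 1 ≤ Real.log 3 := by
    rw [Real.le_log_iff_exp_le (by norm_num)]
    linarith [Real.exp_one_lt_d9]
  have hk : (0 : ℝ) ≤ Nat.log 3 n := Nat.cast_nonneg _
  rw [ternaryWord, List.length_map, Nat.length_digits 3 n (by norm_num) hn]
  push_cast
  nlinarith

/-- The indices `j` that come no later than `i` when a family of weights is listed in
decreasing order, ties being broken by the index. -/
def weightPredecessors (p : ℕ → ℝ≥0∞) (i : ℕ) : Set ℕ :=
  {j | p i < p j ∨ p j = p i ∧ j ≤ i}

lemma self_mem_weightPredecessors (p : ℕ → ℝ≥0∞) (i : ℕ) : i ∈ weightPredecessors p i :=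
  Or.inr ⟨rfl, le_rfl⟩

lemma le_of_mem_weightPredecessors {p : ℕ → ℝ≥0∞} {i j : ℕ} (h : j ∈ weightPredecessors p i) :
    p i ≤ p j :=
  h.elim le_of_lt fun h => h.1.ge

lemma weightPredecessors_finite {p : ℕ → ℝ≥0∞} (hp : ∑' i, p i ≠ ⊤) {i : ℕ} (hi : p i ≠ 0) :
    (weightPredecessors p i).Finite :=
  (ENNReal.finite_const_le_of_tsum_ne_top hp hi).subset fun _ h => le_of_mem_weightPredecessors h

lemma ncard_weightPredecessors_mul_le {p : ℕ → ℝ≥0∞} (hp : ∑' i, p i ≠ ⊤) {i : ℕ}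
    (hi : p i ≠ 0) : ((weightPredecessors p i).ncard : ℝ≥0∞) * p i ≤ ∑' j, p j := by
  have hfin := weightPredecessors_finite hp hi
  rw [Set.ncard_eq_toFinset_card _ hfin, ← nsmul_eq_mul]
  refine (Finset.card_nsmul_le_sum _ p _ fun j hj => ?_).trans (ENNReal.sum_le_tsum _)
  exact le_of_mem_weightPredecessors (hfin.mem_toFinset.1 hj)

lemma weightPredecessors_ssubset {p : ℕ → ℝ≥0∞} {i j : ℕ} (h : j ∈ weightPredecessors p i)
    (hij : i ≠ j) : weightPredecessors p j ⊂ weightPredecessors p i := by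
  refine ⟨fun k hk => ?_, fun hsub => ?_⟩
  · rcases h with h | ⟨h, h'⟩ <;> rcases hk with hk | ⟨hk, hk'⟩
    · exact Or.inl (h.trans hk)
    · exact Or.inl (hk ▸ h)
    · exact Or.inl (h ▸ hk)
    · exact Or.inr ⟨hk.trans h, hk'.trans h'⟩
  · rcases h with h | ⟨h, h'⟩ <;>
      rcases hsub (self_mem_weightPredecessors p i) with hk | ⟨hk, hk'⟩
    · exact lt_asymm h hk
    · exact h.ne hk
    · exact hk.ne h
    · exact hij (le_antisymm hk' h')

lemma mem_weightPredecessors_or (p : ℕ → ℝ≥0∞) (i j : ℕ) :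
    j ∈ weightPredecessors p i ∨ i ∈ weightPredecessors p j := by
  rcases lt_trichotomy (p i) (p j) with h | h | h
  · exact Or.inl (Or.inl h)
  · exact (le_total j i).imp (fun h' => Or.inr ⟨h.symm, h'⟩) fun h' => Or.inr ⟨h, h'⟩
  · exact Or.inr (Or.inl h)

lemma ncard_weightPredecessors_injOn {p : ℕ → ℝ≥0∞} (hp : ∑' i, p i ≠ ⊤) :
    Set.InjOn (fun i => (weightPredecessors p i).ncard) {i | p i ≠ 0} := by
  intro i hi j hj h
  by_contra hij
  rcases mem_weightPredecessors_or p i j with h' | h'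
  · exact (Set.ncard_lt_ncard (weightPredecessors_ssubset h' hij)
      (weightPredecessors_finite hp hi)).ne h.symm
  · exact (Set.ncard_lt_ncard (weightPredecessors_ssubset h' (Ne.symm hij))
      (weightPredecessors_finite hp hj)).ne h

lemma measurable_ncard_weightPredecessors {Y : Type*} [MeasurableSpace Y] {p : Y → ℕ → ℝ≥0∞}
    (hp : ∀ i, Measurable fun y => p y i) (i : ℕ) :
    Measurable fun y => (weightPredecessors (p y) i).ncard := by
  have hS : MeasurableSet {z : Y × ℕ | z.2 ∈ weightPredecessors (p z.1) i} := by
    have h1 : Measurable fun z : Y × ℕ => p z.1 i := (hp i).comp measurable_fst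
    have h2 : Measurable fun z : Y × ℕ => p z.1 z.2 := measurable_from_prod_countable_left hp
    exact (measurableSet_lt h1 h2).union
      ((measurableSet_eq_fun h2 h1).inter (measurable_snd (measurableSet_Iic (a := i))))
  have hcount := (measurable_measure_prodMk_left (ν := Measure.count) hS).ennreal_toReal
  convert Nat.measurable_floor.comp hcount using 1
  funext y
  change (weightPredecessors (p y) i).ncard =
    ⌊(Measure.count (weightPredecessors (p y) i)).toReal⌋₊
  rw [Measure.count_apply (Set.to_countable _).measurableSet]
  rcases Set.finite_or_infinite (weightPredecessors (p y) i) with h | h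
  · rw [← h.cast_ncard_eq]
    simp
  · simp [h.ncard, h.encard_eq]

open Classical in
/-- An injective enumeration of the indices of a summable family of weights, in which an index
of positive weight gets twice its rank in decreasing order, and the others odd numbers. -/
noncomputable def weightCode (p : ℕ → ℝ≥0∞) (i : ℕ) : ℕ :=
  if p i = 0 then 2 * i + 1 else 2 * (weightPredecessors p i).ncard

lemma weightCode_injective {p : ℕ → ℝ≥0∞} (hp : ∑' i, p i ≠ ⊤) :
    Function.Injective (weightCode p) := by
  intro i j h
  unfold weightCode at h
  split_ifs at h with hi hj hj
  · omega
  · omega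
  · omega
  · exact ncard_weightPredecessors_injOn hp hi hj (by simpa using h)

lemma measurable_weightCode {Y : Type*} [MeasurableSpace Y] {p : Y → ℕ → ℝ≥0∞}
    (hp : ∀ i, Measurable fun y => p y i) (i : ℕ) :
    Measurable fun y => weightCode (p y) i :=
  Measurable.ite (hp i (measurableSet_singleton 0)) measurable_const
    ((measurable_ncard_weightPredecessors hp i).const_mul 2)

lemma length_ternaryWord_weightCode_mul_le {p : ℕ → ℝ≥0∞} (hp : ∑' i, p i ≤ 1) (i : ℕ) :
    ((ternaryWord (weightCode p i)).length : ℝ≥0∞) * p i ≤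
      ENNReal.ofReal (Real.negMulLog (p i).toReal) + 2 * p i := by
  by_cases hi : p i = 0
  · simp [hi]
  have hsum : ∑' i, p i ≠ ⊤ := ne_top_of_le_ne_top one_ne_top hp
  have hi1 : p i ≤ 1 := (ENNReal.le_tsum i).trans hp
  have hitop : p i ≠ ⊤ := ne_top_of_le_ne_top one_ne_top hi1
  set x := (p i).toReal with hx
  have hx0 : 0 < x := ENNReal.toReal_pos hi hitop
  have hx1 : x ≤ 1 := ENNReal.toReal_le_of_le_ofReal zero_le_one (by simpa using hi1)
  have hpx : p i = ENNReal.ofReal x := (ENNReal.ofReal_toReal hitop).symm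
  set r := (weightPredecessors p i).ncard with hr
  have hr0 : r ≠ 0 := Set.ncard_ne_zero_of_mem (self_mem_weightPredecessors p i)
    (weightPredecessors_finite hsum hi)
  have hr0' : (0 : ℝ) < r := by exact_mod_cast Nat.pos_of_ne_zero hr0
  have hrx : (r : ℝ) * x ≤ 1 := by
    simpa using ENNReal.toReal_mono one_ne_top ((ncard_weightPredecessors_mul_le hsum hi).trans hp)
  have hlog : Real.log r + Real.log x ≤ 0 := by
    rw [← Real.log_mul hr0'.ne' hx0.ne']
    exact Real.log_nonpos (by positivity) hrx
  have hlen : ((ternaryWord (weightCode p i)).length : ℝ) ≤ 2 - Real.log x := by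
    have h := length_ternaryWord_le (n := 2 * r) (by omega)
    push_cast at h
    rw [Real.log_mul two_ne_zero hr0'.ne'] at h
    rw [weightCode, if_neg hi]
    linarith [Real.log_two_lt_d9]
  have hneg : 0 ≤ Real.negMulLog x := Real.negMulLog_nonneg hx0.le hx1
  rw [hpx, ← ENNReal.ofReal_natCast, ← ENNReal.ofReal_mul (Nat.cast_nonneg _),
    ← ENNReal.ofReal_ofNat 2, ← ENNReal.ofReal_mul (by norm_num),
    ← ENNReal.ofReal_add hneg (by positivity)]
  refine ENNReal.ofReal_le_ofReal ?_
  rw [Real.negMulLog]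
  nlinarith

/-- **Lemma (coding by ternary words).** Let `(X, μ)` be a standard probability
space, let `π : (X, μ) → (Y, ν)` be the factor map associated to a
sub-σ-algebra, and let `μ = ∫_Y μ_y dν(y)` be the disintegration of `μ` over
`ν`.  If `ξ` is a countable Borel partition of `X` with
`H(ξ | F) = ∫_Y Σ_C −μ_y(C) log μ_y(C) dν(y) < ∞`, then there is a Borel
function `L : Y × ξ → {0,1,2}^{<ω}` such that `L(y, ·)` is injective for
ν-a.e. `y` and `∫_Y Σ_C |L(y,C)|·μ_y(C) dν(y) < ∞`. -/
theorem exists_injective_word_coding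
    {X : Type*} [MeasurableSpace X] [StandardBorelSpace X]
    {Y : Type*} [MeasurableSpace Y] [StandardBorelSpace Y]
    (μ : Measure X) [IsProbabilityMeasure μ]
    (ν : Measure Y) [IsProbabilityMeasure ν]
    (π : X → Y) (hπ : Measurable π) (hmap : ν = μ.map π)
    (μy : Y → Measure X)
    (hprob : ∀ y, IsProbabilityMeasure (μy y))
    (hmeas : ∀ s : Set X, MeasurableSet s → Measurable fun y => μy y s)
    (hdis : ∀ s : Set X, MeasurableSet s → μ s = ∫⁻ y, μy y s ∂ν)
    (hfiber : ∀ᵐ y ∂ν, μy y (π ⁻¹' {y}) = 1)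
    (ξ : ℕ → Set X)
    (hmeasξ : ∀ i, MeasurableSet (ξ i))
    (hdisj : Pairwise (Function.onFun Disjoint ξ))
    (hcover : μ (⋃ i, ξ i) = 1)
    (hent : ∫⁻ y, ∑' i, ENNReal.ofReal (Real.negMulLog ((μy y (ξ i)).toReal)) ∂ν ≠ ⊤) :
    ∃ L : Y → ℕ → List (Fin 3),
      (∀ (i : ℕ) (w : List (Fin 3)), MeasurableSet {y | L y i = w}) ∧
      (∀ᵐ y ∂ν, Function.Injective (L y)) ∧
      ∫⁻ y, ∑' i, ((L y i).length : ℝ≥0∞) * μy y (ξ i) ∂ν ≠ ⊤ := by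
  have hsum : ∀ y, ∑' i, μy y (ξ i) ≤ 1 := fun y => by
    have := hprob y
    rw [← measure_iUnion hdisj hmeasξ]
    exact prob_le_one
  refine ⟨fun y i => ternaryWord (weightCode (fun k => μy y (ξ k)) i), fun i w => ?_,
    .of_forall fun y => ternaryWord_injective.comp
      (weightCode_injective (ne_top_of_le_ne_top one_ne_top (hsum y))), ?_⟩
  · exact measurable_weightCode (fun k => hmeas _ (hmeasξ k)) i
      (Set.to_countable {n | ternaryWord n = w}).measurableSet
  · have hbound : ∀ y, ∑' i, ((ternaryWord (weightCode (fun k => μy y (ξ k)) i)).length : ℝ≥0∞) *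
        μy y (ξ i) ≤ ∑' i, ENNReal.ofReal (Real.negMulLog ((μy y (ξ i)).toReal)) + 2 := fun y => by
      refine (ENNReal.tsum_le_tsum fun i =>
        length_ternaryWord_weightCode_mul_le (hsum y) i).trans ?_
      rw [ENNReal.tsum_add, ENNReal.tsum_mul_left]
      gcongr
      exact (mul_le_mul_right (hsum y) 2).trans_eq (mul_one 2)
    refine ne_top_of_le_ne_top ?_ (lintegral_mono hbound)
    rw [lintegral_add_right _ measurable_const, lintegral_const, measure_univ]
    exact ENNReal.add_ne_top.2 ⟨hent, by simp⟩
end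

section
/- Let G and Γ be countable groups with p.m.p. ergodic actions G ↷ (X, μ) and Γ ↷ (X, μ) on the same standard probability space having the same orbits (G·x = Γ·x for a.e. x). Suppose F is a sub-σ-algebra of X invariant under both actions such that: for every g ∈ G there is an F-measurable partition {Z_γ : γ ∈ Γ} of X with g·x = γ·x for all x ∈ Z_γ, and for every γ ∈ Γ there is an F-measurable partition {W_g : g ∈ G} of X with γ·x = g·x for all x ∈ W_g. Then rh_G(X, μ | F) = rh_Γ(X, μ | F). -/
open MeasureTheory ENNReal

section Defs

variable {X : Type*} {mX : MeasurableSpace X}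

/-- The smallest sub-σ-algebra invariant under the action `φ : G →* Perm X`
containing the collection `C` (together with `X`) and all `μ`-null sets. -/
def sigmaA {G : Type*} [Group G] (φ : G →* Equiv.Perm X) (μ : Measure X)
    (C : Set (Set X)) : MeasurableSpace X :=
  sInf {m : MeasurableSpace X |
    (∀ S ∈ C, MeasurableSet[m] S) ∧
    (∀ S : Set X, MeasurableSet[m] S → ∀ g : G, MeasurableSet[m] (⇑(φ g) ⁻¹' S)) ∧
    (∀ S : Set X, μ S = 0 → MeasurableSet[m] S)}

/-- The action `φ` is probability-measure-preserving. -/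
def IsPmpA {G : Type*} [Group G] (φ : G →* Equiv.Perm X) (μ : Measure X) : Prop :=
  ∀ g : G, @MeasurePreserving X X mX mX (⇑(φ g)) μ μ

/-- The action `φ` is ergodic: every invariant Borel set is null or conull. -/
def IsErgodicA {G : Type*} [Group G] (φ : G →* Equiv.Perm X) (μ : Measure X) : Prop :=
  ∀ A : Set X, MeasurableSet[mX] A → (∀ g : G, ⇑(φ g) ⁻¹' A = A) → μ A = 0 ∨ μ A = 1

/-- A countable Borel partition (as an indexed family). -/
def IsPartitionA {ι : Type*} (μ : Measure X) (A : ι → Set X) : Prop :=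
  (∀ i, MeasurableSet[mX] (A i)) ∧ Pairwise (Function.onFun Disjoint A) ∧ μ (⋃ i, A i) = 1

/-- Conditional Shannon entropy `H(α | F)` relative to a sub-σ-algebra `F`. -/
noncomputable def condPartitionEntropyA (μ : Measure X) (F : MeasurableSpace X)
    {ι : Type*} (A : ι → Set X) : ℝ≥0∞ :=
  ∫⁻ x, ∑' i, ENNReal.ofReal
    (Real.negMulLog ((μ[(A i).indicator (fun _ => (1 : ℝ)) | F]) x)) ∂μ

/-- Relative Rokhlin entropy of the action `φ`. -/
noncomputable def relRokhlinEntropyA {G : Type*} [Group G] (φ : G →* Equiv.Perm X)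
    (μ : Measure X) (F : MeasurableSpace X) : ℝ≥0∞ :=
  ⨅ (A : ℕ → Set X)
    (_ : IsPartitionA μ A ∧ mX ≤ sigmaA φ μ (Set.range A) ⊔ F),
    condPartitionEntropyA μ F A

end Defs

section SigmaA

variable {X : Type*} {mX : MeasurableSpace X} {G : Type*} [Group G] {φ : G →* Equiv.Perm X}
  {μ : Measure X} {C : Set (Set X)} {S : Set X}

theorem sigmaA_le {m : MeasurableSpace X} (hC : ∀ S ∈ C, MeasurableSet[m] S)
    (hinv : ∀ S : Set X, MeasurableSet[m] S → ∀ g : G, MeasurableSet[m] (⇑(φ g) ⁻¹' S))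
    (hnull : ∀ S : Set X, μ S = 0 → MeasurableSet[m] S) : sigmaA φ μ C ≤ m :=
  sInf_le ⟨hC, hinv, hnull⟩

theorem measurableSet_sigmaA_of_mem (hS : S ∈ C) : MeasurableSet[sigmaA φ μ C] S :=
  MeasurableSpace.measurableSet_sInf.2 fun _ hm => hm.1 S hS

theorem measurableSet_sigmaA_of_null (hS : μ S = 0) : MeasurableSet[sigmaA φ μ C] S :=
  MeasurableSpace.measurableSet_sInf.2 fun _ hm => hm.2.2 S hS

theorem measurableSet_sigmaA_preimage (hS : MeasurableSet[sigmaA φ μ C] S) (g : G) :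
    MeasurableSet[sigmaA φ μ C] (⇑(φ g) ⁻¹' S) :=
  MeasurableSpace.measurableSet_sInf.2 fun m hm =>
    hm.2.1 S (MeasurableSpace.measurableSet_sInf.1 hS m hm) g

/-- The join of `sigmaA φ μ C` with an invariant σ-algebra is invariant. -/
theorem measurableSet_sigmaA_sup_preimage {F : MeasurableSpace X}
    (hF : ∀ S : Set X, MeasurableSet[F] S → ∀ g : G, MeasurableSet[F] (⇑(φ g) ⁻¹' S))
    (hS : MeasurableSet[sigmaA φ μ C ⊔ F] S) (g : G) :
    MeasurableSet[sigmaA φ μ C ⊔ F] (⇑(φ g) ⁻¹' S) := by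
  have hle : sigmaA φ μ C ⊔ F ≤ (sigmaA φ μ C ⊔ F).map ⇑(φ g) :=
    sup_le
      (fun T hT => (le_sup_left : sigmaA φ μ C ≤ sigmaA φ μ C ⊔ F) _
        (measurableSet_sigmaA_preimage hT g))
      (fun T hT => (le_sup_right : F ≤ sigmaA φ μ C ⊔ F) _ (hF T hT g))
  exact hle S hS

/-- If every transformation of the action `φ` agrees, on the pieces of an `F`-measurable
partition, with transformations of the action `ψ`, then over `F` the `φ`-invariant σ-algebra
generated by `C` is contained in the `ψ`-invariant one. -/
theorem sigmaA_sup_le_sigmaA_sup {Γ : Type*} [Group Γ] [Countable Γ] [IsProbabilityMeasure μ]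
    {ψ : Γ →* Equiv.Perm X} {F : MeasurableSpace X} (hFle : F ≤ mX)
    (hFψ : ∀ S : Set X, MeasurableSet[F] S → ∀ γ : Γ, MeasurableSet[F] (⇑(ψ γ) ⁻¹' S))
    (hexp : ∀ g : G, ∃ Z : Γ → Set X,
      (∀ γ, MeasurableSet[F] (Z γ)) ∧ Pairwise (Function.onFun Disjoint Z) ∧
      μ (⋃ γ, Z γ) = 1 ∧ ∀ γ, ∀ x ∈ Z γ, φ g x = ψ γ x) :
    sigmaA φ μ C ⊔ F ≤ sigmaA ψ μ C ⊔ F := by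
  have hl : sigmaA ψ μ C ≤ sigmaA ψ μ C ⊔ F := le_sup_left
  have hr : F ≤ sigmaA ψ μ C ⊔ F := le_sup_right
  refine sup_le (sigmaA_le (fun S hS => hl _ (measurableSet_sigmaA_of_mem hS)) ?_
    fun S hS => hl _ (measurableSet_sigmaA_of_null hS)) hr
  intro S hS g
  obtain ⟨Z, hZ, -, hZ1, hZφ⟩ := hexp g
  have hnull : μ (⋃ γ, Z γ)ᶜ = 0 :=
    (prob_compl_eq_zero_iff (MeasurableSet.iUnion fun γ => hFle _ (hZ γ))).2 hZ1
  have hdecomp : ⇑(φ g) ⁻¹' S =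
      (⋃ γ, Z γ ∩ ⇑(ψ γ) ⁻¹' S) ∪ (⇑(φ g) ⁻¹' S ∩ (⋃ γ, Z γ)ᶜ) := by
    ext x
    by_cases hx : ∃ γ, x ∈ Z γ
    · obtain ⟨γ, hγ⟩ := hx
      simp only [Set.mem_preimage, Set.mem_union, Set.mem_iUnion, Set.mem_inter_iff,
        Set.mem_compl_iff]
      constructor
      · exact fun h => Or.inl ⟨γ, hγ, hZφ γ x hγ ▸ h⟩
      · rintro (⟨δ, hδ, h⟩ | ⟨h, -⟩)
        · exact (hZφ δ x hδ).symm ▸ h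
        · exact h
    · have hx' : ∀ γ, x ∉ Z γ := not_exists.1 hx
      simp [hx']
  rw [hdecomp]
  refine MeasurableSet.union (MeasurableSet.iUnion fun γ => MeasurableSet.inter (hr _ (hZ γ))
    (measurableSet_sigmaA_sup_preimage hFψ hS γ)) (hl _ (measurableSet_sigmaA_of_null ?_))
  exact measure_mono_null Set.inter_subset_right hnull

end SigmaA

/-- **Proposition (orbit equivalence invariance of relative Rokhlin entropy).**
If `G ↷ (X,μ)` and `Γ ↷ (X,μ)` are p.m.p. ergodic actions with the same orbits
and `F` is a sub-σ-algebra invariant under both actions such that each group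
element's transformation is expressible over `F` in terms of the other group's
action, then `rh_G(X, μ | F) = rh_Γ(X, μ | F)`. -/
theorem relRokhlinEntropy_orbit_equivalence
    {X : Type*} [mX : MeasurableSpace X] [StandardBorelSpace X]
    {G : Type*} [Group G] [Countable G] {Γ : Type*} [Group Γ] [Countable Γ]
    (μ : Measure X) [IsProbabilityMeasure μ]
    (φ : G →* Equiv.Perm X) (ψ : Γ →* Equiv.Perm X)
    (hφpmp : IsPmpA φ μ) (hψpmp : IsPmpA ψ μ)
    (hφerg : IsErgodicA φ μ) (hψerg : IsErgodicA ψ μ)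
    (horb : ∀ᵐ x ∂μ, {y | ∃ g : G, φ g x = y} = {y | ∃ γ : Γ, ψ γ x = y})
    (F : MeasurableSpace X) (hFle : F ≤ mX)
    (hFφ : ∀ S : Set X, MeasurableSet[F] S → ∀ g : G, MeasurableSet[F] (⇑(φ g) ⁻¹' S))
    (hFψ : ∀ S : Set X, MeasurableSet[F] S → ∀ γ : Γ, MeasurableSet[F] (⇑(ψ γ) ⁻¹' S))
    (hexpG : ∀ g : G, ∃ Z : Γ → Set X,
      (∀ γ, MeasurableSet[F] (Z γ)) ∧ Pairwise (Function.onFun Disjoint Z) ∧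
      μ (⋃ γ, Z γ) = 1 ∧ ∀ γ, ∀ x ∈ Z γ, φ g x = ψ γ x)
    (hexpΓ : ∀ γ : Γ, ∃ W : G → Set X,
      (∀ g, MeasurableSet[F] (W g)) ∧ Pairwise (Function.onFun Disjoint W) ∧
      μ (⋃ g, W g) = 1 ∧ ∀ g, ∀ x ∈ W g, ψ γ x = φ g x) :
    relRokhlinEntropyA φ μ F = relRokhlinEntropyA ψ μ F := by
  have hsup (A : ℕ → Set X) :
      sigmaA φ μ (Set.range A) ⊔ F = sigmaA ψ μ (Set.range A) ⊔ F :=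
    le_antisymm (sigmaA_sup_le_sigmaA_sup hFle hFψ hexpG)
      (sigmaA_sup_le_sigmaA_sup hFle hFφ hexpΓ)
  simp only [relRokhlinEntropyA, hsup]
end

section
/- Let G be a countable group acting ergodically by measure-preserving Borel bijections on a standard probability space (X, μ), let B ⊆ X be Borel with μ(B) > 0, let α be a finite Borel partition of X, and let ε > 0. Then there exist n ∈ ℕ and a σ_G(α ∪ {B})-expressible element θ of the pseudo-group [[E_G^X]] with dom(θ) = rng(θ) = B and θ^n = id_B, such that for μ-almost-every x ∈ B the set {θ^i(x) : 0 ≤ i < n} has exactly n elements, the equivalence relation E_θ whose classes are the θ-orbits admits a σ_G(α ∪ {B})-measurable transversal (a Borel set meeting almost every θ-orbit in exactly one point), and for every A ∈ α, μ(A ∩ B)/μ(B) − ε < |{0 ≤ i < n : θ^i(x) ∈ A}|/n < μ(A ∩ B)/μ(B) + ε. -/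
open MeasureTheory Real ENNReal

section Exchange

variable {X : Type*} {mX : MeasurableSpace X} {G : Type*} [Group G] [MulAction G X]
  {μ : Measure X}

theorem IsPmpAction.measure_preimage_smul (hpmp : IsPmpAction G μ) (g : G) {S : Set X}
    (hS : MeasurableSet[mX] S) : μ ((fun x => g • x) ⁻¹' S) = μ S :=
  (hpmp g).measure_preimage hS.nullMeasurableSet

theorem IsPmpAction.measurableSet_preimage_smul (hpmp : IsPmpAction G μ) (g : G) {S : Set X}
    (hS : MeasurableSet[mX] S) : MeasurableSet[mX] ((fun x => g • x) ⁻¹' S) :=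
  (hpmp g).measurable hS

/-- In an ergodic action, two sets of equal measure in an invariant sub-σ-algebra `F` are matched,
up to a null set, by an injection acting through group elements on countably many `F`-pieces. -/
theorem exists_expressible_injection [Countable G] [IsProbabilityMeasure μ]
    (hpmp : IsPmpAction G μ) (herg : IsErgodicAction G μ) {F : MeasurableSpace X} (hF : F ≤ mX)
    (hinv : ∀ (g : G) (S : Set X), MeasurableSet[F] S → MeasurableSet[F] ((fun x => g • x) ⁻¹' S))
    {A A' : Set X} (hA : MeasurableSet[F] A) (hA' : MeasurableSet[F] A') (hAA' : μ A = μ A') :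
    ∃ P : G → Set X, (∀ g, MeasurableSet[F] (P g)) ∧ (∀ g, P g ⊆ A) ∧
      (∀ g, ∀ x ∈ P g, g • x ∈ A') ∧ (∀ g g' x, x ∈ P g → x ∈ P g' → g = g') ∧
      (∀ g g' x x', x ∈ P g → x' ∈ P g' → g • x = g' • x' → x = x') ∧
      μ (A \ ⋃ g, P g) = 0 := by
  obtain ⟨s, hs⟩ := exists_surjective_nat G
  -- the pair of sets still to be matched after `i` group elements have been used
  let Q : G → Set X × Set X → Set X := fun g p => p.1 ∩ (fun x => g • x) ⁻¹' p.2
  let R : ℕ → Set X × Set X := fun i => Nat.rec (A, A')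
    (fun i p => (p.1 \ Q (s i) p, p.2 \ (fun x => (s i)⁻¹ • x) ⁻¹' Q (s i) p)) i
  have R0 : R 0 = (A, A') := rfl
  have R1 : ∀ i, (R (i + 1)).1 = (R i).1 \ Q (s i) (R i) := fun i => rfl
  have R2 : ∀ i, (R (i + 1)).2 = (R i).2 \ (fun x => (s i)⁻¹ • x) ⁻¹' Q (s i) (R i) :=
    fun i => rfl
  have RA : Antitone fun i => (R i).1 := antitone_nat_of_succ_le fun i => by
    rw [R1]; exact Set.sdiff_subset
  have RB : Antitone fun i => (R i).2 := antitone_nat_of_succ_le fun i => by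
    rw [R2]; exact Set.sdiff_subset
  have Rm : ∀ i, MeasurableSet[F] (R i).1 ∧ MeasurableSet[F] (R i).2 := by
    intro i
    induction i with
    | zero => exact ⟨hA, hA'⟩
    | succ i ih =>
      have : MeasurableSet[F] (Q (s i) (R i)) := ih.1.inter (hinv _ _ ih.2)
      exact ⟨by rw [R1]; exact ih.1.diff this, by rw [R2]; exact ih.2.diff (hinv _ _ this)⟩
  have Qm : ∀ i, MeasurableSet[F] (Q (s i) (R i)) := fun i => (Rm i).1.inter (hinv _ _ (Rm i).2)
  have Reqm : ∀ i, μ (R i).1 = μ (R i).2 := by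
    intro i
    induction i with
    | zero => exact hAA'
    | succ i ih =>
      rw [R1, R2, measure_sdiff Set.inter_subset_left (hF _ (Qm i)).nullMeasurableSet
        (measure_ne_top _ _), measure_sdiff _ (hF _ (hinv _ _ (Qm i))).nullMeasurableSet
        (measure_ne_top _ _), ih, hpmp.measure_preimage_smul _ (hF _ (Qm i))]
      rintro x ⟨-, hx⟩
      simpa using hx
  have Qdisj : ∀ i j x, i < j → x ∈ Q (s i) (R i) → x ∉ Q (s j) (R j) := by
    intro i j x hij hx hx'
    have := RA (Nat.succ_le_of_lt hij) hx'.1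
    simp only [Nat.succ_eq_add_one, R1] at this
    exact this.2 hx
  have Qinj : ∀ i j x x', i < j → x ∈ Q (s i) (R i) → x' ∈ Q (s j) (R j) →
      s i • x ≠ s j • x' := by
    intro i j x x' hij hx hx' h
    have := RB (Nat.succ_le_of_lt hij) hx'.2
    simp only [Nat.succ_eq_add_one, R2] at this
    refine this.2 ?_
    rw [← h]
    simpa using hx
  refine ⟨fun g => ⋃ i, ⋃ (_ : s i = g), Q (s i) (R i), ?_, ?_, ?_, ?_, ?_, ?_⟩
  · exact fun g => MeasurableSet.iUnion fun i => MeasurableSet.iUnion fun _ => Qm i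
  · intro g x hx
    simp only [Set.mem_iUnion] at hx
    obtain ⟨i, -, hx⟩ := hx
    exact RA (Nat.zero_le i) hx.1
  · intro g x hx
    simp only [Set.mem_iUnion] at hx
    obtain ⟨i, rfl, hx⟩ := hx
    exact RB (Nat.zero_le i) hx.2
  · intro g g' x hx hx'
    simp only [Set.mem_iUnion] at hx hx'
    obtain ⟨i, rfl, hx⟩ := hx
    obtain ⟨j, rfl, hx'⟩ := hx'
    rcases lt_trichotomy i j with h | h | h
    · exact (Qdisj i j x h hx hx').elim
    · rw [h]
    · exact (Qdisj j i x h hx' hx).elim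
  · intro g g' x x' hx hx' heq
    simp only [Set.mem_iUnion] at hx hx'
    obtain ⟨i, rfl, hx⟩ := hx
    obtain ⟨j, rfl, hx'⟩ := hx'
    rcases lt_trichotomy i j with h | h | h
    · exact (Qinj i j x x' h hx hx' heq).elim
    · subst h
      exact smul_left_cancel _ heq
    · exact (Qinj j i x' x h hx' hx heq.symm).elim
  · set L := ⋂ i, (R i).1 with hL
    set L' := ⋂ i, (R i).2 with hL'
    have hLeq : μ L = μ L' := by
      have h1 := tendsto_measure_iInter_atTop (μ := μ)
        (fun i => (hF _ (Rm i).1).nullMeasurableSet) RA ⟨0, measure_ne_top _ _⟩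
      have h2 := tendsto_measure_iInter_atTop (μ := μ)
        (fun i => (hF _ (Rm i).2).nullMeasurableSet) RB ⟨0, measure_ne_top _ _⟩
      exact tendsto_nhds_unique h1 (h2.congr fun i => (Reqm i).symm)
    have hLm : MeasurableSet[mX] L := MeasurableSet.iInter fun i => hF _ (Rm i).1
    have hsub : A \ ⋃ g, ⋃ i, ⋃ (_ : s i = g), Q (s i) (R i) ⊆ L := by
      rintro x ⟨hx, hxn⟩
      simp only [Set.mem_iUnion, not_exists] at hxn
      refine Set.mem_iInter.2 fun i => ?_
      induction i with
      | zero => exact hx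
      | succ i ih => rw [R1]; exact ⟨ih, hxn _ i rfl⟩
    refine measure_mono_null hsub ?_
    by_contra hpos
    have hsatm : MeasurableSet[mX] (⋃ g : G, (fun x => g • x) ⁻¹' L) :=
      MeasurableSet.iUnion fun g => hpmp.measurableSet_preimage_smul g hLm
    have hsat : μ (⋃ g : G, (fun x => g • x) ⁻¹' L) = 1 := by
      refine (herg _ hsatm ?_).resolve_left ?_
      · intro g
        ext x
        simp only [Set.mem_preimage, Set.mem_iUnion, smul_smul]
        constructor
        · rintro ⟨a, ha⟩; exact ⟨_, ha⟩
        · rintro ⟨a, ha⟩; exact ⟨a * g⁻¹, by simpa using ha⟩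
      · intro h0
        refine hpos (measure_mono_null ?_ h0)
        exact fun x hx => Set.mem_iUnion.2 ⟨1, by simpa using hx⟩
    have hnull : μ L' = 0 := by
      rw [← prob_compl_eq_zero_iff hsatm] at hsat
      refine measure_mono_null ?_ hsat
      intro y hy hy'
      simp only [Set.mem_iUnion, Set.mem_preimage] at hy'
      obtain ⟨g, hg⟩ := hy'
      obtain ⟨i, hi⟩ := hs g⁻¹
      have hQ : g • y ∈ Q (s i) (R i) := by
        refine ⟨Set.mem_iInter.1 hg i, ?_⟩
        simpa [hi] using Set.mem_iInter.1 hy i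
      have := Set.mem_iInter.1 hg (i + 1)
      rw [R1] at this
      exact this.2 hQ
    exact hpos (hLeq.trans hnull)

/-- Finitely many disjoint `F`-sets of equal measure are cyclically permuted by an `F`-expressible
element of the pseudo-group. -/
theorem exists_expressible_cycle [Countable G] [IsProbabilityMeasure μ]
    (hpmp : IsPmpAction G μ) (herg : IsErgodicAction G μ) {F : MeasurableSpace X} (hF : F ≤ mX)
    (hinv : ∀ (g : G) (S : Set X), MeasurableSet[F] S → MeasurableSet[F] ((fun x => g • x) ⁻¹' S))
    {n : ℕ} [NeZero n] {S : ZMod n → Set X} (hS : ∀ i, MeasurableSet[F] (S i))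
    (hdisj : Pairwise (Function.onFun Disjoint S)) (heq : ∀ i j, μ (S i) = μ (S j)) :
    ∃ (θ : X → X) (Z : G → Set X), (∀ g, MeasurableSet[F] (Z g)) ∧
      Pairwise (Function.onFun Disjoint Z) ∧ (⋃ g, Z g) ⊆ (⋃ i, S i) ∧
      μ ((⋃ i, S i) \ ⋃ g, Z g) = 0 ∧ (∀ g, ∀ x ∈ Z g, θ x = g • x) ∧
      ∀ x ∈ ⋃ g, Z g, θ^[n] x = x ∧ ∃ i : ZMod n, ∀ j : ℕ, θ^[j] x ∈ S (i + j) := by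
  choose P hPm hPs hPmaps hPd hPinj hPnull using fun i =>
    exists_expressible_injection hpmp herg hF hinv (hS 0) (hS i) (heq 0 i)
  have hmem : ∀ i j x, x ∈ S i → x ∈ S j → i = j := fun i j x hi hj => by
    by_contra hne
    exact Set.disjoint_left.1 (hdisj hne) hi hj
  set D := ⋂ i, ⋃ g, P i g with hD
  have hDm : MeasurableSet[F] D :=
    MeasurableSet.iInter fun i => MeasurableSet.iUnion fun g => hPm i g
  have hDS : D ⊆ S 0 := fun x hx => by
    obtain ⟨g, hg⟩ := Set.mem_iUnion.1 (Set.mem_iInter.1 hx 0)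
    exact hPs _ _ hg
  have hDμ : μ D = μ (S 0) := by
    refine le_antisymm (measure_mono hDS) ?_
    rw [← tsub_eq_zero_iff_le, ← measure_sdiff hDS (hF _ hDm).nullMeasurableSet
      (measure_ne_top _ _), hD, Set.sdiff_iInter]
    exact measure_iUnion_null hPnull
  have hψ : ∀ i, ∀ x : X, ∃ g, x ∈ D → x ∈ P i g := by
    intro i x
    by_cases hx : x ∈ D
    · obtain ⟨g, hg⟩ := Set.mem_iUnion.1 (Set.mem_iInter.1 hx i)
      exact ⟨g, fun _ => hg⟩
    · exact ⟨1, fun h => (hx h).elim⟩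
  choose ψ hψ using hψ
  let Z : G → Set X := fun g =>
    ⋃ i, ⋃ a, (fun y => a⁻¹ • y) ⁻¹' (D ∩ P i a ∩ P (i + 1) (g * a))
  have hZ : ∀ g y, y ∈ Z g ↔
      ∃ i, ∃ x ∈ D, y = ψ i x • x ∧ g = ψ (i + 1) x * (ψ i x)⁻¹ := by
    intro g y
    simp only [Z, Set.mem_iUnion, Set.mem_preimage]
    constructor
    · rintro ⟨i, a, ⟨hx, hx1⟩, hx2⟩
      refine ⟨i, a⁻¹ • y, hx, ?_⟩
      rw [← hPd _ _ _ _ hx1 (hψ i _ hx), ← hPd _ _ _ _ hx2 (hψ (i + 1) _ hx)]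
      simp
    · rintro ⟨i, x, hx, rfl, rfl⟩
      refine ⟨i, ψ i x, ?_⟩
      simpa using ⟨⟨hx, hψ i x hx⟩, hψ (i + 1) x hx⟩
  have hpS : ∀ i, ∀ x ∈ D, ψ i x • x ∈ S i := fun i x hx => hPmaps _ _ _ (hψ i x hx)
  have hpinj : ∀ i i', ∀ x ∈ D, ∀ x' ∈ D, ψ i x • x = ψ i' x' • x' → i = i' ∧ x = x' := by
    intro i i' x hx x' hx' h
    obtain rfl := hmem i i' _ (hpS i x hx) (h ▸ hpS i' x' hx')
    exact ⟨rfl, hPinj _ _ _ _ _ (hψ i x hx) (hψ i x' hx') h⟩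
  have hZd : ∀ g g' y, y ∈ Z g → y ∈ Z g' → g = g' := by
    intro g g' y hy hy'
    obtain ⟨i, x, hx, rfl, rfl⟩ := (hZ _ _).1 hy
    obtain ⟨i', x', hx', h, rfl⟩ := (hZ _ _).1 hy'
    obtain ⟨rfl, rfl⟩ := hpinj _ _ _ hx _ hx' h
    rfl
  have hZU : ∀ y, y ∈ ⋃ g, Z g ↔ ∃ i, ∃ x ∈ D, y = ψ i x • x := by
    intro y
    simp only [Set.mem_iUnion, hZ]
    exact ⟨fun ⟨g, i, x, hx, h, _⟩ => ⟨i, x, hx, h⟩, fun ⟨i, x, hx, h⟩ => ⟨_, i, x, hx, h, rfl⟩⟩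
  have hZm : ∀ g, MeasurableSet[F] (Z g) := fun g =>
    MeasurableSet.iUnion fun i => MeasurableSet.iUnion fun a =>
      hinv _ _ ((hDm.inter (hPm _ _)).inter (hPm _ _))
  have hθ : ∀ y : X, ∃ z, ∀ g, y ∈ Z g → z = g • y := by
    intro y
    by_cases hy : ∃ g, y ∈ Z g
    · obtain ⟨g, hg⟩ := hy
      exact ⟨g • y, fun g' hg' => by rw [hZd _ _ _ hg hg']⟩
    · exact ⟨y, fun g hg => (hy ⟨g, hg⟩).elim⟩
  choose θ hθ using hθ
  have hstep : ∀ i, ∀ x ∈ D, θ (ψ i x • x) = ψ (i + 1) x • x := by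
    intro i x hx
    rw [hθ _ _ ((hZ _ _).2 ⟨i, x, hx, rfl, rfl⟩)]
    simp [smul_smul]
  have hiter : ∀ i, ∀ x ∈ D, ∀ j : ℕ, θ^[j] (ψ i x • x) = ψ (i + j) x • x := by
    intro i x hx j
    induction j with
    | zero => simp
    | succ j ih => rw [Function.iterate_succ_apply', ih, hstep _ _ hx]; simp [add_assoc]
  refine ⟨θ, Z, hZm, ?_, ?_, ?_, fun g x hx => hθ _ _ hx, ?_⟩
  · intro g g' hne
    exact Set.disjoint_left.2 fun y hy hy' => hne (hZd _ _ _ hy hy')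
  · intro y hy
    obtain ⟨i, x, hx, rfl⟩ := (hZU y).1 hy
    exact Set.mem_iUnion.2 ⟨i, hpS i x hx⟩
  · rw [Set.iUnion_sdiff]
    refine measure_iUnion_null fun i => ?_
    let E : Set X := ⋃ a, (fun y => a⁻¹ • y) ⁻¹' (D ∩ P i a)
    have hEm : MeasurableSet[F] E :=
      MeasurableSet.iUnion fun a => hinv _ _ (hDm.inter (hPm _ _))
    have hEψ : ∀ y ∈ E, ∃ x ∈ D, y = ψ i x • x := by
      intro y hy
      obtain ⟨a, hx, hx1⟩ := Set.mem_iUnion.1 hy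
      refine ⟨a⁻¹ • y, hx, ?_⟩
      rw [← hPd _ _ _ _ hx1 (hψ i _ hx)]
      simp
    have hES : E ⊆ S i := by
      intro y hy
      obtain ⟨x, hx, rfl⟩ := hEψ y hy
      exact hpS i x hx
    have hEμ : μ E = μ (S i) := by
      rw [heq i 0, ← hDμ, measure_iUnion]
      · simp_rw [hpmp.measure_preimage_smul _ (hF _ (hDm.inter (hPm _ _)))]
        rw [← measure_iUnion]
        · congr 1
          rw [← Set.inter_iUnion]
          exact Set.inter_eq_left.2 fun x hx => Set.mem_iInter.1 hx i
        · intro a b hab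
          exact Set.disjoint_left.2 fun x hx hx' => hab (hPd _ _ _ _ hx.2 hx'.2)
        · exact fun a => hF _ (hDm.inter (hPm _ _))
      · intro a b hab
        refine Set.disjoint_left.2 fun y hy hy' => hab ?_
        have h := hPinj _ _ _ _ _ hy.2 hy'.2 (by simp)
        have h' := hy'.2
        rw [← h] at h'
        exact hPd _ _ _ _ hy.2 h'
      · exact fun a => hF _ (hinv _ _ (hDm.inter (hPm _ _)))
    refine measure_mono_null (t := S i \ E) ?_ ?_
    · refine Set.sdiff_subset_sdiff_right fun y hy => (hZU y).2 ?_
      obtain ⟨x, hx, rfl⟩ := hEψ y hy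
      exact ⟨i, x, hx, rfl⟩
    · rw [measure_sdiff hES (hF _ hEm).nullMeasurableSet (measure_ne_top _ _), hEμ, tsub_self]
  · intro y hy
    obtain ⟨i, x, hx, rfl⟩ := (hZU y).1 hy
    refine ⟨by simp [hiter i x hx], i, fun j => ?_⟩
    rw [hiter i x hx]
    exact hpS _ x hx

end Exchange

section Splitting

variable {X : Type*} {F mX : MeasurableSpace X} {μ : Measure X}

theorem exists_measureReal_Iic_eq (ν : Measure ℝ) [IsFiniteMeasure ν] [NullSingletonClass ν]
    {c : ℝ} (h0 : 0 < c) (hc : c < ν.real Set.univ) : ∃ t, ν.real (Set.Iic t) = c := by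
  have hcont : Continuous fun t => ν.real (Set.Iic t) := by
    have h : (fun t => ν.real (Set.Iic t)) =
        fun t => ν.real (Set.Iic 0) + ∫ _ in (0 : ℝ)..t, (1 : ℝ) ∂ν := by
      funext t
      rw [← intervalIntegral.integral_Iic_sub_Iic (by simp [IntegrableOn])
        (by simp [IntegrableOn])]
      simp
    rw [h]
    exact continuous_const.add (intervalIntegral.continuous_primitive (fun a b => by simp) 0)
  have hbot : Filter.Tendsto (fun t => ν.real (Set.Iic t)) Filter.atBot (nhds 0) := by
    have h := tendsto_measure_iInter_atBot (μ := ν) (s := fun t : ℝ => Set.Iic t)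
      (fun t => measurableSet_Iic.nullMeasurableSet) (fun _ _ => Set.Iic_subset_Iic.2)
      ⟨0, measure_ne_top _ _⟩
    rw [_root_.iInter_Iic_eq_empty_iff.2 (by simp), measure_empty] at h
    exact (ENNReal.tendsto_toReal ENNReal.zero_ne_top).comp h
  have htop : Filter.Tendsto (fun t => ν.real (Set.Iic t)) Filter.atTop
      (nhds (ν.real Set.univ)) :=
    (ENNReal.tendsto_toReal (measure_ne_top _ _)).comp (tendsto_measure_Iic_atTop ν)
  obtain ⟨a, ha⟩ := (hbot.eventually (ge_mem_nhds h0)).exists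
  obtain ⟨b, hb⟩ := (htop.eventually (le_mem_nhds hc)).exists
  exact mem_range_of_exists_le_of_exists_ge hcont ⟨a, ha⟩ ⟨b, hb⟩

/-- A set is divisible at will as soon as some measurable function has only null level sets. -/
theorem exists_subset_measureReal_eq [IsFiniteMeasure μ] (hF : F ≤ mX)
    {h : X → ℝ} (hh : Measurable[F] h) (hna : ∀ t, μ (h ⁻¹' {t}) = 0) {E : Set X}
    (hE : MeasurableSet[F] E) {c : ℝ} (h0 : 0 ≤ c) (hc : c ≤ μ.real E) :
    ∃ E' ⊆ E, MeasurableSet[F] E' ∧ μ.real E' = c := by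
  rcases h0.eq_or_lt with rfl | h0
  · exact ⟨∅, Set.empty_subset _, @MeasurableSet.empty _ F, by simp⟩
  rcases hc.eq_or_lt with rfl | hc
  · exact ⟨E, subset_rfl, hE, rfl⟩
  have hh' : Measurable h := hh.mono hF le_rfl
  have hmap : ∀ S, MeasurableSet S → ((μ.restrict E).map h) S = μ (h ⁻¹' S ∩ E) := fun S hS => by
    rw [Measure.map_apply hh' hS, Measure.restrict_apply (hh' hS)]
  have : NullSingletonClass ((μ.restrict E).map h) := ⟨fun t => by
    rw [hmap _ (measurableSet_singleton t)]
    exact measure_mono_null Set.inter_subset_left (hna t)⟩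
  obtain ⟨t, ht⟩ := exists_measureReal_Iic_eq ((μ.restrict E).map h) h0 (by
    simpa [measureReal_def, hmap] using hc)
  refine ⟨h ⁻¹' Set.Iic t ∩ E, Set.inter_subset_right, (hh measurableSet_Iic).inter hE, ?_⟩
  rw [← ht, measureReal_def, measureReal_def, hmap _ measurableSet_Iic]

theorem exists_disjoint_subsets_measureReal_eq [IsFiniteMeasure μ] (hF : F ≤ mX) {h : X → ℝ}
    (hh : Measurable[F] h) (hna : ∀ t, μ (h ⁻¹' {t}) = 0) {c : ℝ} (h0 : 0 ≤ c) (N : ℕ)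
    {E : Set X} (hE : MeasurableSet[F] E) (hc : N * c ≤ μ.real E) :
    ∃ S : Fin N → Set X, (∀ i, MeasurableSet[F] (S i)) ∧ (∀ i, S i ⊆ E) ∧
      Pairwise (Function.onFun Disjoint S) ∧ ∀ i, μ.real (S i) = c := by
  induction N generalizing E with
  | zero => exact ⟨fun _ => ∅, fun i => i.elim0, fun i => i.elim0, fun i => i.elim0,
      fun i => i.elim0⟩
  | succ N ih =>
    push_cast at hc
    have hN : 0 ≤ N * c := by positivity
    obtain ⟨E', hE'E, hE'm, hE'c⟩ := exists_subset_measureReal_eq hF hh hna hE h0 (by linarith)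
    obtain ⟨S, hSm, hSE, hSd, hSc⟩ := ih (hE.diff hE'm) (by
      rw [measureReal_sdiff hE'E (hF _ hE'm), hE'c]
      linarith)
    refine ⟨Fin.cons E' S, ?_, ?_, ?_, ?_⟩
    · exact Fin.cases hE'm hSm
    · exact Fin.cases hE'E fun i => (hSE i).trans Set.sdiff_subset
    · have hd : ∀ i, Disjoint E' (S i) := fun i =>
        Set.disjoint_left.2 fun x hx hx' => (hSE i hx').2 hx
      refine Fin.cases (Fin.cases (fun hne => (hne rfl).elim) fun j _ => ?_)
        fun i => Fin.cases (fun _ => ?_) fun j hne => ?_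
      · exact hd j
      · exact (hd i).symm
      · exact hSd (fun hij => hne (congrArg Fin.succ hij))
    · exact Fin.cases hE'c hSc

end Splitting

section Division

/-- If `F` carries a real function without level sets of positive measure, then `B` is divided
into `F`-sets of equal measure, enough of them contained in each piece of the partition. -/
theorem exists_division_of_nonatomic {X : Type*} {F mX : MeasurableSpace X} {μ : Measure X}
    [IsFiniteMeasure μ] (hF : F ≤ mX) {h : X → ℝ} (hh : Measurable[F] h)
    (hna : ∀ t, μ (h ⁻¹' {t}) = 0) {B : Set X} (hB : MeasurableSet[F] B) (hB0 : 0 < μ.real B)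
    {m : ℕ} {α : Fin m → Set X} (hα : ∀ k, MeasurableSet[F] (α k))
    (hαd : Pairwise (Function.onFun Disjoint α)) {δ : ℝ} (hδ : 0 < δ) :
    ∃ (ι : Type) (_ : Fintype ι) (_ : Nonempty ι) (S : ι → Set X),
      (∀ i, MeasurableSet[F] (S i)) ∧ (∀ i, S i ⊆ B) ∧ Pairwise (Function.onFun Disjoint S) ∧
      (∀ i j, μ (S i) = μ (S j)) ∧ μ (B \ ⋃ i, S i) = 0 ∧
      ∀ k, Fintype.card ι * (μ.real (α k ∩ B) / μ.real B - δ) ≤ {i | S i ⊆ α k}.ncard := by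
  obtain ⟨n', hn'⟩ := exists_nat_one_div_lt hδ
  let n := n' + 1
  have hn : (0 : ℝ) < n := by positivity
  have hnδ : 1 < n * δ := by
    have : (1 : ℝ) / n < δ := by simpa [n] using hn'
    rwa [div_lt_iff₀' hn] at this
  set c := μ.real B / n with hc
  have hc0 : 0 < c := by positivity
  have hnc : n * c = μ.real B := by rw [hc]; field_simp
  let N : Fin m → ℕ := fun k => ⌊n * (μ.real (α k ∩ B) / μ.real B)⌋₊
  have hN : ∀ k, N k * c ≤ μ.real (α k ∩ B) := fun k => by
    have := Nat.floor_le (a := n * (μ.real (α k ∩ B) / μ.real B)) (by positivity)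
    calc N k * c ≤ (n * (μ.real (α k ∩ B) / μ.real B)) * c := by gcongr
      _ = μ.real (α k ∩ B) := by rw [hc]; field_simp
  choose S hSm hSs hSd hSc using fun k => exists_disjoint_subsets_measureReal_eq hF hh hna hc0.le
    (N k) ((hα k).inter hB) (hN k)
  let S₁ : (Σ k, Fin (N k)) → Set X := fun p => S p.1 p.2
  have hS₁m : ∀ p, MeasurableSet[F] (S₁ p) := fun p => hSm _ _
  have hS₁B : ∀ p, S₁ p ⊆ B := fun p => (hSs _ _).trans Set.inter_subset_right
  have hS₁d : Pairwise (Function.onFun Disjoint S₁) := by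
    rintro ⟨k, i⟩ ⟨l, j⟩ hne
    by_cases hkl : k = l
    · subst hkl
      exact hSd k (fun hij => hne (congrArg (Sigma.mk k) hij))
    · exact (hαd hkl).mono ((hSs _ _).trans Set.inter_subset_left)
        ((hSs _ _).trans Set.inter_subset_left)
  have hU : μ.real (⋃ p, S₁ p) = (∑ k, N k : ℕ) * c := by
    rw [measureReal_iUnion_fintype hS₁d (fun p => hF _ (hS₁m p))]
    simp [S₁, hSc]
  have hUB : ⋃ p, S₁ p ⊆ B := Set.iUnion_subset hS₁B
  have hsum : ∑ k, N k ≤ n := by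
    have h1 := measureReal_mono (μ := μ) hUB
    rw [hU, ← hnc] at h1
    exact_mod_cast le_of_mul_le_mul_right h1 hc0
  have hUm : MeasurableSet[F] (⋃ p, S₁ p) := MeasurableSet.iUnion hS₁m
  obtain ⟨S₂, hS₂m, hS₂s, hS₂d, hS₂c⟩ := exists_disjoint_subsets_measureReal_eq hF hh hna hc0.le
    (n - ∑ k, N k) (hB.diff hUm) (by
      rw [measureReal_sdiff hUB (hF _ hUm), hU, ← hnc]
      push_cast [hsum]
      linarith)
  let T : (Σ k, Fin (N k)) ⊕ Fin (n - ∑ k, N k) → Set X := Sum.elim S₁ S₂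
  have hcard : Fintype.card ((Σ k, Fin (N k)) ⊕ Fin (n - ∑ k, N k)) = n := by
    simp
    omega
  have hTm : ∀ i, MeasurableSet[F] (T i) := Sum.rec hS₁m hS₂m
  have hTB : ∀ i, T i ⊆ B := Sum.rec hS₁B fun i => (hS₂s i).trans Set.sdiff_subset
  have h12 : ∀ i j, Disjoint (S₁ i) (S₂ j) := fun i j => Set.disjoint_left.2 fun x hx hx' =>
    (hS₂s j hx').2 (Set.mem_iUnion.2 ⟨i, hx⟩)
  have hTd : Pairwise (Function.onFun Disjoint T) := by
    rintro (i | i) (j | j) hne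
    · exact hS₁d fun hij => hne (congrArg _ hij)
    · exact h12 i j
    · exact (h12 j i).symm
    · exact hS₂d fun hij => hne (congrArg _ hij)
  have hTc : ∀ i, μ.real (T i) = c := Sum.rec (fun i => hSc _ _) hS₂c
  refine ⟨_, inferInstance, Fintype.card_pos_iff.1 (by rw [hcard]; omega), T, hTm, hTB, hTd,
    ?_, ?_, ?_⟩
  · intro i j
    exact (measureReal_eq_measureReal_iff).1 ((hTc i).trans (hTc j).symm)
  · have hUm : MeasurableSet (⋃ i, T i) := MeasurableSet.iUnion fun i => hF _ (hTm i)
    rw [← measureReal_eq_zero_iff, measureReal_sdiff (Set.iUnion_subset hTB) hUm,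
      measureReal_iUnion_fintype hTd (fun p => hF _ (hTm p))]
    simp only [hTc, Finset.sum_const, Finset.card_univ, hcard, nsmul_eq_mul, hnc, sub_self]
  · intro k
    have h1 : N k ≤ {i | T i ⊆ α k}.ncard := by
      have hinj : Function.Injective fun i : Fin (N k) =>
          (Sum.inl ⟨k, i⟩ : (Σ k, Fin (N k)) ⊕ Fin (n - ∑ k, N k)) := fun i j hij => by
        simpa using hij
      calc N k = (Set.range fun i : Fin (N k) =>
          (Sum.inl ⟨k, i⟩ : (Σ k, Fin (N k)) ⊕ Fin (n - ∑ k, N k))).ncard := by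
            rw [← Set.image_univ, Set.ncard_image_of_injective _ hinj]; simp
        _ ≤ _ := by
          refine Set.ncard_le_ncard ?_ (Set.toFinite _)
          rintro _ ⟨i, rfl⟩
          exact (hSs k i).trans Set.inter_subset_left
    have h2 := Nat.lt_floor_add_one (n * (μ.real (α k ∩ B) / μ.real B))
    have h3 : (N k : ℝ) ≤ {i | T i ⊆ α k}.ncard := by exact_mod_cast h1
    rw [hcard, mul_sub]
    linarith

/-- If some level set of a function with equivariant level sets generating `F` has positive
measure, then `B` is divided into such level sets, distributed exactly as the partition. -/
theorem exists_division_of_atom {X : Type*} {F mX : MeasurableSpace X} {G : Type*} [Group G]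
    [MulAction G X] {μ : Measure X} [IsProbabilityMeasure μ]
    (hpmp : IsPmpAction G μ) (herg : IsErgodicAction G μ)
    (hF : F ≤ mX) {h : X → ℝ} (hh : Measurable[F] h)
    (hsat : ∀ S : Set X, MeasurableSet[F] S → ∀ x y, h x = h y → x ∈ S → y ∈ S)
    (hequi : ∀ (g : G) x y, h x = h y → h (g • x) = h (g • y))
    {t₀ : ℝ} (hatom : μ (h ⁻¹' {t₀}) ≠ 0) {B : Set X} (hB : MeasurableSet[F] B)
    (hB0 : 0 < μ.real B) {m : ℕ} {α : Fin m → Set X} (hα : ∀ k, MeasurableSet[F] (α k)) :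
    ∃ (ι : Type) (_ : Fintype ι) (_ : Nonempty ι) (S : ι → Set X),
      (∀ i, MeasurableSet[F] (S i)) ∧ (∀ i, S i ⊆ B) ∧ Pairwise (Function.onFun Disjoint S) ∧
      (∀ i j, μ (S i) = μ (S j)) ∧ μ (B \ ⋃ i, S i) = 0 ∧
      ∀ k, Fintype.card ι * (μ.real (α k ∩ B) / μ.real B) ≤ {i | S i ⊆ α k}.ncard := by
  set a := μ (h ⁻¹' {t₀}) with ha
  have hm : ∀ t, MeasurableSet[F] (h ⁻¹' {t}) := fun t => hh (measurableSet_singleton t)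
  have hd : Pairwise (Function.onFun Disjoint fun t => h ⁻¹' {t}) := fun s t hst =>
    Disjoint.preimage h (Set.disjoint_singleton.2 hst)
  let O : Set ℝ := {t | μ (h ⁻¹' {t}) = a}
  have hO : O.Finite := (Measure.finite_const_le_meas_of_disjoint_iUnion μ
    (pos_iff_ne_zero.2 hatom) (fun t => hF _ (hm t)) hd (measure_ne_top _ _)).subset
    fun t ht => ht.ge
  have hW : μ (h ⁻¹' O) = 1 := by
    have hWm : MeasurableSet (h ⁻¹' O) := hF _ (hh hO.measurableSet)
    refine (herg _ hWm ?_).resolve_left ?_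
    · intro g
      ext x
      have : (fun y => g • y) ⁻¹' (h ⁻¹' {h (g • x)}) = h ⁻¹' {h x} := by
        ext y
        simp only [Set.mem_preimage, Set.mem_singleton_iff]
        exact ⟨fun hy => by simpa using hequi g⁻¹ _ _ hy, hequi g _ _⟩
      simp only [O, Set.mem_preimage, Set.mem_ofPred_eq]
      rw [← this, hpmp.measure_preimage_smul g (hF _ (hm _))]
    · intro h0
      refine hatom (measure_mono_null ?_ h0)
      exact Set.preimage_mono (Set.singleton_subset_iff.2 ha.symm)
  have hWc : μ (h ⁻¹' O)ᶜ = 0 := (prob_compl_eq_zero_iff (hF _ (hh hO.measurableSet))).2 hW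
  let I : Set ℝ := {t | t ∈ O ∧ h ⁻¹' {t} ⊆ B}
  have hI : I.Finite := hO.subset fun t ht => ht.1
  have : Fintype I := hI.fintype
  let S : I → Set X := fun t => h ⁻¹' {(t : ℝ)}
  have hSd : Pairwise (Function.onFun Disjoint S) := fun s t hst =>
    hd fun hs => hst (Subtype.ext hs)
  have hSa : ∀ i, μ (S i) = a := fun i => i.2.1
  have hSB : ∀ i, S i ⊆ B := fun i => i.2.2
  have hnull : ∀ C : Set X, MeasurableSet[F] C → C ⊆ B →
      μ (C \ ⋃ i ∈ {i | S i ⊆ C}, S i) = 0 := by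
    intro C hC hCB
    refine measure_mono_null ?_ hWc
    rintro x ⟨hx, hx'⟩ hxO
    have hsub : h ⁻¹' {h x} ⊆ C := fun y hy => hsat C hC x y (Eq.symm hy) hx
    exact hx' (Set.mem_iUnion₂.2 ⟨⟨h x, hxO, hsub.trans hCB⟩, hsub, rfl⟩)
  have hBnull : μ (B \ ⋃ i, S i) = 0 := by
    refine measure_mono_null (Set.sdiff_subset_sdiff_right ?_) (hnull B hB subset_rfl)
    exact Set.iUnion₂_subset fun i _ => Set.subset_iUnion S i
  have hle : ∀ C : Set X, MeasurableSet[F] C → C ⊆ B →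
      μ.real C ≤ {i | S i ⊆ C}.ncard * a.toReal := by
    intro C hC hCB
    have hfin : ({i | S i ⊆ C} : Set I).Finite := Set.toFinite _
    calc μ.real C ≤ μ.real (⋃ i ∈ hfin.toFinset, S i) := by
          refine ENNReal.toReal_mono (measure_ne_top _ _) (measure_mono_ae ?_)
          refine ae_le_set.2 ?_
          simpa using hnull C hC hCB
      _ ≤ ∑ i ∈ hfin.toFinset, μ.real (S i) := measureReal_biUnion_finset_le _ _
      _ = _ := by
        simp only [measureReal_def, hSa, Finset.sum_const, nsmul_eq_mul]
        rw [Set.ncard_eq_toFinset_card _ hfin]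
  have hBle : Fintype.card I * a.toReal ≤ μ.real B := by
    have := measureReal_mono (μ := μ) (Set.iUnion_subset hSB)
    rw [measureReal_iUnion_fintype hSd (fun p => hF _ (hm _))] at this
    simpa [measureReal_def, hSa] using this
  refine ⟨I, inferInstance, ?_, S, fun i => hm _, hSB, hSd,
    fun i j => (hSa i).trans (hSa j).symm, hBnull, ?_⟩
  · by_contra hne
    rw [not_nonempty_iff] at hne
    have : μ B = 0 := by simpa using hBnull
    simp [measureReal_def, this] at hB0
  · intro k
    have h1 := hle _ ((hα k).inter hB) Set.inter_subset_right
    have h2 : {i | S i ⊆ α k ∩ B}.ncard ≤ {i | S i ⊆ α k}.ncard :=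
      Set.ncard_le_ncard (fun i hi => hi.trans Set.inter_subset_left) (Set.toFinite _)
    have h2' : ({i | S i ⊆ α k ∩ B}.ncard : ℝ) ≤ {i | S i ⊆ α k}.ncard := by exact_mod_cast h2
    rw [← mul_div_assoc, div_le_iff₀ hB0]
    calc Fintype.card I * μ.real (α k ∩ B)
        ≤ Fintype.card I * ({i | S i ⊆ α k}.ncard * a.toReal) := by
          gcongr
          exact h1.trans (by gcongr)
      _ = {i | S i ⊆ α k}.ncard * (Fintype.card I * a.toReal) := by ring
      _ ≤ _ := by gcongr

end Division

/-- The itinerary of a point of `X` through a family `C` of sets under the action of `G`. -/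
def itinerary (G : Type*) [Group G] {X : Type*} [MulAction G X] {J : Type*} (C : J → Set X)
    (x : X) (g : G) (j : J) : Prop :=
  g • x ∈ C j

theorem measurable_itinerary (G : Type*) [Group G] {X : Type*} [MulAction G X] {J : Type*}
    {M : MeasurableSpace X} {C : J → Set X}
    (hC : ∀ (g : G) (j : J), MeasurableSet ((fun x => g • x) ⁻¹' C j)) :
    Measurable (itinerary G C) :=
  measurable_pi_iff.2 fun g => measurable_pi_iff.2 fun j => measurableSet_setOfPred.1 (hC g j)

/-- The invariant σ-algebra generated by finitely many sets is, up to null sets, generated by a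
real function whose level sets are permuted by the action. -/
theorem exists_equivariant_real (G : Type*) [Group G] [Countable G] {X : Type*} [MulAction G X]
    {J : Type*} [Countable J] (C : J → Set X) :
    ∃ h : X → ℝ, (∀ (g : G) x y, h x = h y → h (g • x) = h (g • y)) ∧
      (∀ (g : G) S, MeasurableSet[MeasurableSpace.comap h inferInstance] S →
        MeasurableSet[MeasurableSpace.comap h inferInstance] ((fun x => g • x) ⁻¹' S)) ∧
      (∀ j, MeasurableSet[MeasurableSpace.comap h inferInstance] (C j)) ∧
      ∀ M : MeasurableSpace X, (∀ (g : G) (j : J), MeasurableSet[M] ((fun x => g • x) ⁻¹' C j)) →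
        MeasurableSpace.comap h inferInstance ≤ M := by
  obtain ⟨e, he⟩ := exists_measurableEmbedding_real (G → J → Prop)
  have hcomap : MeasurableSpace.comap (e ∘ itinerary G C) inferInstance =
      MeasurableSpace.comap (itinerary G C) inferInstance := by
    rw [← MeasurableSpace.comap_comp, he.comap_eq]
  have hmul : ∀ (g : G) x, itinerary G C (g • x) = fun a => itinerary G C x (a * g) := by
    intro g x
    funext a j
    simp [itinerary, mul_smul]
  have hC : ∀ (g : G) j, MeasurableSet[MeasurableSpace.comap (itinerary G C) inferInstance]
      ((fun x => g • x) ⁻¹' C j) := fun g j => by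
    refine ⟨{f | f g j}, ?_, rfl⟩
    exact measurableSet_setOfPred.2 ((measurable_pi_apply j).comp (measurable_pi_apply g))
  refine ⟨e ∘ itinerary G C, ?_, ?_, ?_, ?_⟩
  · intro g x y hxy
    have h : itinerary G C x = itinerary G C y := he.injective hxy
    simp [hmul, h]
  · rw [hcomap]
    rintro g _ ⟨U, hU, rfl⟩
    refine ⟨(fun (f : G → J → Prop) a => f (a * g)) ⁻¹' U, ?_, ?_⟩
    · exact (measurable_pi_iff.2 fun a => measurable_pi_apply (a * g)) hU
    · ext x
      simp [hmul]
  · rw [hcomap]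
    intro j
    simpa using hC 1 j
  · intro M hM
    rw [hcomap]
    exact (measurable_itinerary G hM).comap_le

/-- **Lemma (well-distributed finite orbits inside a set).** Given `B` of
positive measure, a finite partition `α`, and `ε > 0`, there are `n ∈ ℕ` and a
`σ_G(α ∪ {B})`-expressible pseudo-group element `θ : B → B` with `θ^n = id_B`
whose orbit equivalence relation has all classes of size `n`, admits a
`σ_G(α ∪ {B})`-measurable transversal, and whose classes approximate the
distribution of `α` on `B` to within `ε`. -/
theorem exists_well_distributed_orbits
    {X : Type*} [mX : MeasurableSpace X] [StandardBorelSpace X]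
    (G : Type*) [Group G] [Countable G] [MulAction G X]
    (μ : Measure X) [IsProbabilityMeasure μ]
    (hpmp : IsPmpAction G μ) (herg : IsErgodicAction G μ)
    (B : Set X) (hB : MeasurableSet[mX] B) (hBpos : 0 < μ B)
    (m : ℕ) (α : Fin m → Set X) (hα : IsPartition μ α)
    (ε : ℝ) (hε : 0 < ε) :
    ∃ (n : ℕ) (θ : X → X) (Z : G → Set X) (T : Set X), 0 < n ∧
      (∀ g, MeasurableSet[sigmaG G μ (insert B (Set.range α))] (Z g)) ∧
      Pairwise (Function.onFun Disjoint Z) ∧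
      (⋃ g, Z g) ⊆ B ∧ μ (B \ ⋃ g, Z g) = 0 ∧
      (∀ g, ∀ x ∈ Z g, θ x = g • x) ∧
      MeasurableSet[sigmaG G μ (insert B (Set.range α))] T ∧
      (∀ᵐ x ∂μ, x ∈ B →
        ((∀ i : ℕ, θ^[i] x ∈ B) ∧
         θ^[n] x = x ∧
         Function.Injective (fun i : Fin n => θ^[(i : ℕ)] x) ∧
         (∃! i : Fin n, θ^[(i : ℕ)] x ∈ T) ∧
         ∀ k : Fin m,
           (μ (α k ∩ B)).toReal / (μ B).toReal - ε <
             ({i : Fin n | θ^[(i : ℕ)] x ∈ α k}.ncard : ℝ) / n ∧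
           ({i : Fin n | θ^[(i : ℕ)] x ∈ α k}.ncard : ℝ) / n <
             (μ (α k ∩ B)).toReal / (μ B).toReal + ε)) := by
  classical
  let C : Option (Fin m) → Set X := fun j => j.elim B α
  obtain ⟨h, hequi, hinv, hCm, hmin⟩ := exists_equivariant_real G C
  set F := MeasurableSpace.comap h inferInstance
  have hh : Measurable[F] h := comap_measurable h
  have hBF : MeasurableSet[F] B := hCm none
  have hαF : ∀ k, MeasurableSet[F] (α k) := fun k => hCm (some k)
  have hF : F ≤ mX := hmin mX fun g j => hpmp.measurableSet_preimage_smul g (by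
    cases j with
    | none => exact hB
    | some k => exact hα.1 k)
  have hFσ : F ≤ sigmaG G μ (insert B (Set.range α)) := hmin _ fun g j => by
    refine MeasurableSpace.measurableSet_sInf.2 fun M hM => hM.2.1 _ (hM.1 _ ?_) g
    cases j with
    | none => exact Set.mem_insert _ _
    | some k => exact Set.mem_insert_of_mem _ ⟨k, rfl⟩
  have hB0 : 0 < μ.real B := ENNReal.toReal_pos hBpos.ne' (measure_ne_top _ _)
  set δ : ℝ := ε / (m + 1) with hδdef
  have hδ : 0 < δ := by positivity
  obtain ⟨ι, _, _, S, hSm, hSB, hSd, hSμ, hSnull, hScount⟩ :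
      ∃ (ι : Type) (_ : Fintype ι) (_ : Nonempty ι) (S : ι → Set X),
      (∀ i, MeasurableSet[F] (S i)) ∧ (∀ i, S i ⊆ B) ∧ Pairwise (Function.onFun Disjoint S) ∧
      (∀ i j, μ (S i) = μ (S j)) ∧ μ (B \ ⋃ i, S i) = 0 ∧
      ∀ k, Fintype.card ι * (μ.real (α k ∩ B) / μ.real B - δ) ≤ {i | S i ⊆ α k}.ncard := by
    by_cases hna : ∀ t, μ (h ⁻¹' {t}) = 0
    · exact exists_division_of_nonatomic hF hh hna hBF hB0 hαF hα.2.1 hδ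
    · push Not at hna
      obtain ⟨t, ht⟩ := hna
      obtain ⟨ι, i1, i2, S, h1, h2, h3, h4, h5, h6⟩ :=
        exists_division_of_atom hpmp herg hF hh (by
          rintro _ ⟨U, -, rfl⟩ x y hxy hx
          exact (congrArg (· ∈ U) hxy).mp hx) hequi ht hBF hB0 hαF
      exact ⟨ι, i1, i2, S, h1, h2, h3, h4, h5, fun k => le_trans (by gcongr; linarith) (h6 k)⟩
  set n := Fintype.card ι with hn
  have hn0 : 0 < n := Fintype.card_pos
  have : NeZero n := ⟨hn0.ne'⟩
  let e : ZMod n ≃ ι := Fintype.equivOfCardEq (ZMod.card n)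
  obtain ⟨θ, Z, hZm, hZd, hZS, hZnull, hZθ, hcyc⟩ := exists_expressible_cycle hpmp herg hF hinv
    (S := S ∘ e) (fun i => hSm _) (fun i j hij => hSd (e.injective.ne hij)) (fun i j => hSμ _ _)
  have hSe : ⋃ i, (S ∘ e) i = ⋃ i, S i := e.surjective.iUnion_comp S
  rw [hSe] at hZS hZnull
  have hZB : μ (B \ ⋃ g, Z g) = 0 :=
    measure_mono_null (sdiff_triangle _ _ _) (measure_union_null hSnull hZnull)
  refine ⟨n, θ, Z, S (e 0), hn0, fun g => hFσ _ (hZm g), hZd,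
    hZS.trans (Set.iUnion_subset hSB), hZB, hZθ, hFσ _ (hSm _), ?_⟩
  filter_upwards [measure_eq_zero_iff_ae_notMem.1 hZB] with x hx hxB
  obtain ⟨hper, i₀, hi₀⟩ := hcyc x (by_contra fun hxZ => hx ⟨hxB, hxZ⟩)
  have hmem : ∀ i j x, x ∈ S i → x ∈ S j → i = j := fun i j x hi hj => by
    by_contra hne
    exact Set.disjoint_left.1 (hSd hne) hi hj
  let φ : Fin n → ι := fun j => e (i₀ + (j : ℕ))
  have hφ : ∀ j : Fin n, θ^[(j : ℕ)] x ∈ S (φ j) := fun j => hi₀ j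
  have hφinj : Function.Injective φ := by
    intro j j' hjj
    have := (ZMod.natCast_eq_natCast_iff' _ _ _).1 (add_left_cancel (e.injective hjj))
    rw [Nat.mod_eq_of_lt j.2, Nat.mod_eq_of_lt j'.2] at this
    exact Fin.ext this
  have hφbij : Function.Bijective φ :=
    (Fintype.bijective_iff_injective_and_card φ).2 ⟨hφinj, by simp [hn]⟩
  have hmemφ : ∀ j i, θ^[((j : Fin n) : ℕ)] x ∈ S i ↔ φ j = i := fun j i =>
    ⟨fun hj => hmem _ _ _ (hφ j) hj, fun hj => hj ▸ hφ j⟩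
  have hlow : ∀ k, n * (μ.real (α k ∩ B) / μ.real B - δ) ≤
      {j : Fin n | θ^[(j : ℕ)] x ∈ α k}.ncard := by
    intro k
    refine (hScount k).trans ?_
    have h1 : {i | S i ⊆ α k} = φ '' (φ ⁻¹' {i | S i ⊆ α k}) :=
      (Set.image_preimage_eq _ hφbij.surjective).symm
    rw [h1, Set.ncard_image_of_injective _ hφinj]
    have h2 : φ ⁻¹' {i | S i ⊆ α k} ⊆ {j : Fin n | θ^[(j : ℕ)] x ∈ α k} := fun j hj =>
      hj (hφ j)
    exact_mod_cast Set.ncard_le_ncard h2 (Set.toFinite _)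
  have hcountsum : ∑ k, ({j : Fin n | θ^[(j : ℕ)] x ∈ α k}.ncard : ℝ) ≤ n := by
    have h1 : ∑ k, {j : Fin n | θ^[(j : ℕ)] x ∈ α k}.ncard ≤ n := by
      simp_rw [Set.ncard_eq_toFinset_card']
      rw [← Finset.card_biUnion]
      · exact (Finset.card_le_univ _).trans (by simp)
      · intro k _ l _ hkl
        refine Finset.disjoint_left.2 fun j hj hj' => ?_
        simp only [Set.mem_toFinset, Set.mem_ofPred_eq] at hj hj'
        exact Set.disjoint_left.1 (hα.2.1 hkl) hj hj'
    exact_mod_cast h1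
  have hpsum : ∑ k, μ.real (α k ∩ B) / μ.real B = 1 := by
    rw [← Finset.sum_div, ← measureReal_iUnion_fintype, ← Set.iUnion_inter,
      div_eq_one_iff_eq hB0.ne']
    · refine congrArg ENNReal.toReal (measure_congr ?_)
      have h1 : μ (⋃ k, α k)ᶜ = 0 :=
        (prob_compl_eq_zero_iff (MeasurableSet.iUnion hα.1)).2 hα.2.2
      filter_upwards [measure_eq_zero_iff_ae_notMem.1 h1] with y hy
      exact propext ⟨fun hy' => hy'.2, fun hy' => ⟨not_not.1 hy, hy'⟩⟩
    · exact fun k l hkl => (hα.2.1 hkl).mono Set.inter_subset_left Set.inter_subset_left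
    · exact fun k => (hα.1 k).inter hB
  have hnR : (0 : ℝ) < n := by exact_mod_cast hn0
  refine ⟨fun i => hSB _ (hi₀ i), hper, ?_, ?_, fun k => ?_⟩
  · intro j j' hjj
    have h1 := hφ j
    simp only at hjj
    rw [hjj] at h1
    exact hφinj (hmem _ _ _ h1 (hφ j'))
  · simp_rw [hmemφ]
    exact hφbij.existsUnique (e 0)
  · have hmδ : (m + 1) * δ = ε := by rw [hδdef]; field_simp
    have hm0 : (0 : ℝ) ≤ m := Nat.cast_nonneg m
    have hk := hlow k
    refine ⟨?_, ?_⟩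
    · rw [lt_div_iff₀ hnR]
      have hm1 : (1 : ℝ) ≤ m := by exact_mod_cast (k.pos)
      have : δ < ε := by nlinarith
      change (μ.real (α k ∩ B) / μ.real B - ε) * n < _
      nlinarith
    · rw [div_lt_iff₀ hnR]
      change _ < (μ.real (α k ∩ B) / μ.real B + ε) * n
      have h1 := Finset.sum_le_sum fun l (_ : l ∈ Finset.univ.erase k) => hlow l
      rw [← Finset.add_sum_erase _ _ (Finset.mem_univ k)] at hcountsum hpsum
      rw [← Finset.mul_sum, Finset.sum_sub_distrib, Finset.sum_const, nsmul_eq_mul] at h1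
      have h2 : ((Finset.univ.erase k).card : ℝ) * δ ≤ m * δ := by
        gcongr
        simp
      nlinarith
end
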